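/- arXiv:1708.03566 — 4 statements merged into one kernel-verified Lean document; each statement's English description precedes it below -/
import Mathlib

section
/- Let Λ be a finitely generated central subgroup of GL₂(ℂ) (so Λ consists of scalar matrices). Then the quotient group Γ = GL₂(ℂ)/Λ is strongly Jordan. -/
/-- A group is *Jordan* if there is a constant `J` such that every finite subgroup
contains a normal abelian subgroup of index at most `J`. -/
def IsJordanGroup (Γ : Type*) [Group Γ] : Prop :=
  ∃ J : ℕ, ∀ G : Subgroup Γ, Finite G →
    ∃ A : Subgroup G, A.Normal ∧ (∀ x y : A, x * y = y * x) ∧ A.index ≤ J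

/-- A group has *bounded finite subgroups* if there is a constant `B` bounding the
order of all of its finite subgroups. -/
def HasBoundedFiniteSubgroups (Γ : Type*) [Group Γ] : Prop :=
  ∃ B : ℕ, ∀ G : Subgroup Γ, Finite G → Nat.card G ≤ B

/-- A group is *strongly Jordan* if it is Jordan and there is a constant `R` such that
every finite subgroup is generated by at most `R` elements. -/
def IsStronglyJordanGroup (Γ : Type*) [Group Γ] : Prop :=
  IsJordanGroup Γ ∧ ∃ R : ℕ, ∀ G : Subgroup Γ, Finite G →
    ∃ S : Finset Γ, S.card ≤ R ∧ Subgroup.closure (S : Set Γ) = G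

open Matrix


lemma aux_unip (X : Matrix (Fin 2) (Fin 2) ℂ) (hdet : X.det = 1) (v : Fin 2 → ℂ) (hv : v ≠ 0)
    (hXv : X *ᵥ v = v) (n : ℕ) (hn : n ≠ 0) (hX : X ^ n = 1) : X = 1 := by
  have h1 : (X - 1).det = 0 := by
    apply Matrix.exists_mulVec_eq_zero_iff.mp
    exact ⟨v, hv, by rw [Matrix.sub_mulVec, hXv, Matrix.one_mulVec, sub_self]⟩
  have h2 : (X - 1) * (X - 1) = 0 := by
    rw [Matrix.det_fin_two] at hdet h1
    simp at h1
    have htr : X 0 0 + X 1 1 = 2 := by linear_combination hdet - h1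
    ext i j
    fin_cases i <;> fin_cases j <;> simp [Matrix.mul_apply, Fin.sum_univ_two]
    · linear_combination (X 0 0) * htr - hdet
    · linear_combination (X 0 1) * htr
    · linear_combination (X 1 0) * htr
    · linear_combination (X 1 1) * htr - hdet
  have h3 : ∀ k : ℕ, X ^ k = 1 + (k : ℂ) • (X - 1) := by
    intro k
    induction k with
    | zero => simp
    | succ k ih =>
      have : X = 1 + (X - 1) := by abel
      rw [pow_succ, ih]
      nth_rw 2 [this]
      rw [add_mul, mul_add, mul_add, smul_mul_assoc, smul_mul_assoc, h2, one_mul, one_mul]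
      push_cast
      rw [add_smul, smul_zero, mul_one, one_smul]
      abel
  have h4 := h3 n
  rw [hX] at h4
  have h5 : (n : ℂ) • (X - 1) = 0 := by
    simpa using h4.symm
  rcases smul_eq_zero.mp h5 with h | h
  · exact absurd (by exact_mod_cast h) hn
  · exact sub_eq_zero.mp h

lemma aux_eig (X Y : Matrix (Fin 2) (Fin 2) ℂ) (v : Fin 2 → ℂ) (μ : ℂ)
    (hY : Y *ᵥ v = μ • v) (hns : ∀ c : ℂ, Y ≠ c • 1) (hc : X * Y = Y * X) :
    v 0 * (X *ᵥ v) 1 - v 1 * (X *ᵥ v) 0 = 0 := by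
  by_contra hD
  apply hns μ
  have hYw : Y *ᵥ (X *ᵥ v) = μ • (X *ᵥ v) := by
    rw [Matrix.mulVec_mulVec, ← hc, ← Matrix.mulVec_mulVec, hY, Matrix.mulVec_smul]
  generalize X *ᵥ v = w at *
  have e1 := congrFun hY 0
  have e2 := congrFun hY 1
  have e3 := congrFun hYw 0
  have e4 := congrFun hYw 1
  simp [Matrix.mulVec, dotProduct, Fin.sum_univ_two] at e1 e2 e3 e4
  ext i j
  fin_cases i <;> fin_cases j <;> simp <;> apply mul_left_cancel₀ hD
  · linear_combination w 1 * e1 - v 1 * e3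
  · linear_combination v 0 * e3 - w 0 * e1
  · linear_combination w 1 * e2 - v 1 * e4
  · linear_combination v 0 * e4 - w 0 * e2

lemma aux_cyc {H : Type} [Group H] [Finite H] (ρ : H →* Matrix (Fin 2) (Fin 2) ℂ)
    (hinj : Function.Injective ρ) (hdet : ∀ h, (ρ h).det = 1) (y : H)
    (hns : ∀ c : ℂ, ρ y ≠ c • 1) : IsCyclic (Subgroup.centralizer {y}) := by
  obtain ⟨μ, hμ⟩ := Module.End.exists_eigenvalue (Matrix.toLin' (ρ y))
  obtain ⟨v, hv⟩ := hμ.exists_hasEigenvector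
  have hYv : ρ y *ᵥ v = μ • v := by
    have := hv.apply_eq_smul
    simpa using this
  have hv0 : v ≠ 0 := hv.2
  obtain ⟨i, hi⟩ : ∃ i, v i ≠ 0 := by
    by_contra h
    push Not at h
    exact hv0 (funext h)
  have key : ∀ x : Subgroup.centralizer {y},
      ρ x *ᵥ v = ((ρ x *ᵥ v) i / v i) • v := by
    intro x
    have hc : ρ x * ρ y = ρ y * ρ x := by
      rw [← map_mul, ← map_mul, Subgroup.mem_centralizer_singleton_iff.mp x.2]
    have := aux_eig _ _ v μ hYv hns hc
    set w := ρ x *ᵥ v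
    ext j
    rw [Pi.smul_apply, smul_eq_mul]
    field_simp
    fin_cases i <;> fin_cases j <;> first | (simp; done) | (simp; linear_combination this) | (simp; linear_combination -this)
  have hinv : ∀ x : Subgroup.centralizer {y}, ∀ c : ℂ, ρ x *ᵥ v = c • v →
      (ρ x *ᵥ v) i / v i = c := by
    intro x c h
    rw [h, Pi.smul_apply, smul_eq_mul, mul_div_cancel_right₀ _ hi]
  let χ : Subgroup.centralizer {y} →* ℂ :=
    { toFun := fun x => (ρ x *ᵥ v) i / v i
      map_one' := by simp [hi]
      map_mul' := by
        intro x z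
        apply hinv
        rw [Subgroup.coe_mul, map_mul, ← Matrix.mulVec_mulVec, key z, Matrix.mulVec_smul, key x,
          smul_smul, mul_comm, ← key x, ← key z] }
  apply isCyclic_of_injective_ringHom χ
  rw [injective_iff_map_eq_one]
  intro x hx
  have hx' : (ρ x *ᵥ v) i / v i = 1 := hx
  have h1 := key x
  rw [hx', one_smul] at h1
  have h2 : ρ (x : H) = 1 := by
    refine aux_unip _ (hdet _) v hv0 h1 (Nat.card H) Nat.card_pos.ne' ?_
    rw [← map_pow, pow_card_eq_one', map_one]
  ext
  apply hinj
  rw [h2]; simp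

open scoped Matrix.Norms.L2Operator in
lemma key_unitary : ∃ J : ℕ, ∀ (H : Type) [Group H] [Finite H]
    (ρ : H →* Matrix (Fin 2) (Fin 2) ℂ) (_ : Function.Injective ρ)
    (_ : ∀ h, (ρ h).det = 1) (_ : ∀ h, ρ h ∈ unitary (Matrix (Fin 2) (Fin 2) ℂ)),
    ∃ a : H, (Subgroup.zpowers a).index ≤ J := by
  have : ProperSpace (Matrix (Fin 2) (Fin 2) ℂ) := FiniteDimensional.proper ℂ _
  obtain ⟨t, -, htf, ht⟩ := finite_cover_balls_of_compact
    (isCompact_closedBall (0 : Matrix (Fin 2) (Fin 2) ℂ) 1) (e := 1/4) (by norm_num)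
  refine ⟨htf.toFinset.card, ?_⟩
  intro H _ _ ρ hinj hdet huni
  -- index bound
  have hidx : ∀ A : Subgroup H, (∀ h, ‖ρ h - 1‖ < 1/2 → h ∈ A) → A.index ≤ htf.toFinset.card := by
    intro A hA
    have hc : ∀ q : H ⧸ A, ∃ c : htf.toFinset, ‖ρ q.out - c‖ < 1/4 := by
      intro q
      have : ρ q.out ∈ Metric.closedBall (0 : Matrix (Fin 2) (Fin 2) ℂ) 1 := by
        rw [mem_closedBall_zero_iff, CStarRing.norm_of_mem_unitary (huni _)]
      have := ht this
      simp only [Set.mem_iUnion] at this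
      obtain ⟨c, hc, h⟩ := this
      exact ⟨⟨c, by simpa using hc⟩, by rwa [mem_ball_iff_norm] at h⟩
    choose f hf using hc
    have hfi : Function.Injective f := by
      intro p q hpq
      have h1 := hf p
      have h2 := hf q
      rw [hpq] at h1
      have h3 : ‖ρ q.out - ρ p.out‖ < 1/2 := by
        have e : ρ q.out - ρ p.out = (ρ q.out - f q) - (ρ p.out - f q) := by abel
        rw [e]
        have := norm_sub_le (ρ q.out - f q) (ρ p.out - f q)
        linarith
      have h4 : p.out⁻¹ * q.out ∈ A := by
        apply hA
        have e : ρ (p.out⁻¹ * q.out) - 1 = ρ (p.out⁻¹) * (ρ q.out - ρ p.out) := by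
          rw [mul_sub, ← map_mul, ← map_mul, inv_mul_cancel, map_one]
        rw [e, CStarRing.norm_mem_unitary_mul _ (huni _)]
        exact h3
      rw [← QuotientGroup.out_eq' p, ← QuotientGroup.out_eq' q]
      exact QuotientGroup.eq.mpr h4
    rw [Subgroup.index_eq_card]
    have := Nat.card_le_card_of_injective f hfi
    exact this.trans_eq (by rw [Nat.card_eq_fintype_card, Fintype.card_coe])
  have hsc : ∀ h, ‖ρ h - 1‖ < 1/2 → h ≠ 1 → ∀ c : ℂ, ρ h ≠ c • 1 := by
    intro h hh h1 c hc
    have hd := hdet h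
    rw [hc] at hd
    simp at hd
    rcases hd with rfl | rfl
    · apply h1; apply hinj; rw [hc]; simp
    · rw [hc] at hh
      have : ((-1 : ℂ) • (1 : Matrix (Fin 2) (Fin 2) ℂ) - 1) = (-2 : ℂ) • 1 := by
        rw [neg_smul, neg_smul, two_smul, one_smul]; abel
      rw [this, norm_smul, norm_one] at hh
      norm_num at hh
  by_cases hex : ∃ h, ‖ρ h - 1‖ < 1/2 ∧ h ≠ 1
  · have hfin : {h : H | ‖ρ h - 1‖ < 1/2 ∧ h ≠ 1}.Finite := Set.toFinite _
    obtain ⟨y, ⟨hy1, hy2⟩, hmin⟩ := Set.exists_min_image _ (fun h => ‖ρ h - 1‖) hfin hex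
    have hcyc := aux_cyc ρ hinj hdet y (hsc y hy1 hy2)
    obtain ⟨a, ha⟩ := (Subgroup.isCyclic_iff_exists_zpowers_eq_top (Subgroup.centralizer {y})).mp hcyc
    refine ⟨a, hidx _ ?_⟩
    intro x hx
    rw [ha, Subgroup.mem_centralizer_singleton_iff]
    by_contra hne
    have hpos : 0 < ‖ρ y - 1‖ := by
      rw [norm_pos_iff, sub_ne_zero]
      intro h; apply hy2; apply hinj; rw [h, map_one]
    have hcomm : ‖ρ (x * y * (y * x)⁻¹) - 1‖ < ‖ρ y - 1‖ := by
      have e : ρ (x * y * (y * x)⁻¹) - 1 =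
          ((ρ x - 1) * (ρ y - 1) - (ρ y - 1) * (ρ x - 1)) * ρ ((y * x)⁻¹) := by
        have : (1 : Matrix (Fin 2) (Fin 2) ℂ) = ρ (y * x) * ρ ((y * x)⁻¹) := by
          rw [← map_mul, mul_inv_cancel, map_one]
        rw [map_mul]
        nth_rw 1 [this]
        rw [← sub_mul, map_mul, map_mul]
        congr 1
        noncomm_ring
      rw [e, CStarRing.norm_mul_mem_unitary _ (huni _)]
      have n1 := norm_sub_le ((ρ x - 1) * (ρ y - 1)) ((ρ y - 1) * (ρ x - 1))
      have n2 := norm_mul_le (ρ x - 1) (ρ y - 1)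
      have n3 := norm_mul_le (ρ y - 1) (ρ x - 1)
      nlinarith
    have hne' : x * y * (y * x)⁻¹ ≠ 1 := by
      intro h; exact hne (mul_inv_eq_one.mp h)
    have := hmin _ ⟨hcomm.trans hy1, hne'⟩
    linarith
  · push Not at hex
    exact ⟨1, hidx _ (fun h hh => by rw [hex h hh]; exact one_mem _)⟩

open scoped ComplexOrder MatrixOrder Matrix.Norms.L2Operator in
lemma exists_unitarize (H : Subgroup (GL (Fin 2) ℂ)) [Finite H] :
    ∃ B : GL (Fin 2) ℂ, ∀ h ∈ H,
      (B * h * B⁻¹).val ∈ unitary (Matrix (Fin 2) (Fin 2) ℂ) := by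
  have := Fintype.ofFinite H
  let P : Matrix (Fin 2) (Fin 2) ℂ := ∑ h : H, (h.1.val)ᴴ * h.1.val
  have hP : P.PosDef := by
    refine Matrix.posDef_sum Finset.univ_nonempty fun h _ => ?_
    apply Matrix.PosDef.conjTranspose_mul_self
    exact Matrix.mulVec_injective_iff_isUnit.mpr h.1.isUnit
  have hinv : ∀ k : H, (k.1.val)ᴴ * P * k.1.val = P := by
    intro k
    simp only [P, Finset.mul_sum, Finset.sum_mul]
    refine Fintype.sum_equiv (Equiv.mulRight k) _ _ ?_
    intro h
    simp [Matrix.mul_assoc]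
  obtain ⟨B, hB⟩ : ∃ B : GL (Fin 2) ℂ, P = (B.val)ᴴ * B.val := by
    obtain ⟨y, hy, h⟩ := CStarAlgebra.isStrictlyPositive_iff_eq_star_mul_self.mp
      hP.isStrictlyPositive
    exact ⟨hy.unit, h⟩
  refine ⟨B, fun h hh => ?_⟩
  rw [← Matrix.unitaryGroup, Matrix.mem_unitaryGroup_iff']
  have := hinv ⟨h, hh⟩
  simp only at this
  rw [Matrix.star_eq_conjTranspose]
  simp only [Units.val_mul, Matrix.conjTranspose_mul]
  have h2 : ((B⁻¹).val)ᴴ * P * (B⁻¹).val = 1 := by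
    rw [hB, Matrix.mul_assoc, Matrix.mul_assoc, ← Units.val_mul, mul_inv_cancel, Units.val_one, Matrix.mul_one, ← Matrix.conjTranspose_mul, ← Units.val_mul, mul_inv_cancel, Units.val_one, Matrix.conjTranspose_one]
  rw [← this, hB] at h2
  simpa only [Matrix.mul_assoc] using h2

lemma key_GL : ∃ J : ℕ, ∀ H : Subgroup (GL (Fin 2) ℂ), Finite H → (∀ h ∈ H, h.val.det = 1) →
    ∃ a ∈ H, (Subgroup.zpowers a).relIndex H ≤ J := by
  obtain ⟨J, hJ⟩ := key_unitary
  refine ⟨J, fun H hH hdet => ?_⟩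
  obtain ⟨B, hB⟩ := exists_unitarize H
  let ρ : H →* Matrix (Fin 2) (Fin 2) ℂ :=
    ((Units.coeHom _).comp (MulAut.conj B).toMonoidHom).comp H.subtype
  have hρ : ∀ h : H, ρ h = (B * h.1 * B⁻¹).val := fun h => rfl
  have h1 : Function.Injective ρ := by
    intro x y hxy
    rw [hρ, hρ] at hxy
    have := Units.ext hxy
    ext1
    simpa using this
  have h2 : ∀ h, (ρ h).det = 1 := by
    intro h
    rw [hρ]
    simp only [Units.val_mul, Matrix.det_mul, hdet _ h.2, mul_one]
    rw [← Matrix.det_mul, ← Units.val_mul, mul_inv_cancel, Units.val_one, Matrix.det_one]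
  obtain ⟨a, ha⟩ := hJ H ρ h1 h2 (fun h => hB _ h.2)
  refine ⟨a.1, a.2, ?_⟩
  rw [Subgroup.relIndex]
  convert ha using 2
  ext x
  rw [Subgroup.mem_subgroupOf, Subgroup.mem_zpowers_iff, Subgroup.mem_zpowers_iff]
  simp [Subtype.ext_iff]

def GenLE {G : Type*} [Group G] (M : Subgroup G) (d : ℕ) : Prop :=
  ∃ S : Finset G, S.card ≤ d ∧ Subgroup.closure (S : Set G) = M

lemma GenLE.map {G G' : Type*} [Group G] [Group G'] {M : Subgroup G} {d : ℕ} (h : GenLE M d)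
    (f : G →* G') : GenLE (M.map f) d := by
  classical
  obtain ⟨S, hS, rfl⟩ := h
  exact ⟨S.image f, Finset.card_image_le.trans hS, by rw [Finset.coe_image, MonoidHom.map_closure]⟩

lemma GenLE.of_le_zpowers {G : Type*} [Group G] {M : Subgroup G} {a : G}
    (h : M ≤ Subgroup.zpowers a) : GenLE M 1 := by
  have : IsCyclic M := isCyclic_of_injective (Subgroup.inclusion h) (Subgroup.inclusion_injective h)
  obtain ⟨b, hb⟩ := (Subgroup.isCyclic_iff_exists_zpowers_eq_top M).mp this
  exact ⟨{b}, by simp, by rw [Finset.coe_singleton, ← Subgroup.zpowers_eq_closure, hb]⟩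

lemma GenLE.ext {G G' : Type*} [Group G] [Group G'] {M : Subgroup G} {d e : ℕ} (f : G →* G')
    (h1 : GenLE (M ⊓ f.ker) d) (h2 : GenLE (M.map f) e) : GenLE M (d + e) := by
  classical
  obtain ⟨S, hS, hSc⟩ := h1
  obtain ⟨T, hT, hTc⟩ := h2
  have hl : ∀ t : T, ∃ m ∈ M, f m = t := by
    intro t
    have : (t : G') ∈ M.map f := hTc ▸ Subgroup.subset_closure t.2
    simpa using this
  choose l hlM hlf using hl
  refine ⟨S ∪ T.attach.image l, ?_, ?_⟩
  · refine (Finset.card_union_le _ _).trans (Nat.add_le_add hS ?_)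
    exact Finset.card_image_le.trans (by simpa using hT)
  · set P := Subgroup.closure ((S ∪ T.attach.image l : Finset G) : Set G) with hP
    have hker : M ⊓ f.ker ≤ P := by
      rw [← hSc]; apply Subgroup.closure_mono; simp
    apply le_antisymm
    · rw [hP, Subgroup.closure_le]
      intro x hx
      simp only [Finset.coe_union, Set.mem_union, Finset.mem_coe, Finset.mem_image] at hx
      rcases hx with hx | ⟨t, -, rfl⟩
      · have : x ∈ M ⊓ f.ker := hSc ▸ Subgroup.subset_closure hx
        exact this.1
      · exact hlM t
    · have hPM : P ≤ M := by
        rw [hP, Subgroup.closure_le]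
        intro x hx
        simp only [Finset.coe_union, Set.mem_union, Finset.mem_coe, Finset.mem_image] at hx
        rcases hx with hx | ⟨t, -, rfl⟩
        · have : x ∈ M ⊓ f.ker := hSc ▸ Subgroup.subset_closure hx
          exact this.1
        · exact hlM t
      have hmap : M.map f ≤ P.map f := by
        rw [← hTc, Subgroup.closure_le]
        intro t ht
        refine ⟨l ⟨t, ht⟩, ?_, hlf _⟩
        apply Subgroup.subset_closure
        simp only [Finset.coe_union, Set.mem_union, Finset.mem_coe, Finset.mem_image]
        exact Or.inr ⟨_, Finset.mem_attach _ _, rfl⟩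
      intro x hx
      obtain ⟨p, hp, hpx⟩ := hmap (Subgroup.mem_map_of_mem f hx)
      have : x * p⁻¹ ∈ P := by
        apply hker
        refine ⟨M.mul_mem hx (M.inv_mem (hPM hp)), ?_⟩
        change f _ = 1
        rw [map_mul, map_inv, hpx, mul_inv_cancel]
      simpa using P.mul_mem this hp

lemma GenLE.cyc_ext {G : Type*} [Group G] {M N : Subgroup G} [N.Normal] {d : ℕ} {a : G}
    (hM : M ≤ N ⊔ Subgroup.zpowers a) (h : GenLE (M ⊓ N) d) : GenLE M (d + 1) := by
  apply GenLE.ext (QuotientGroup.mk' N)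
  · rwa [QuotientGroup.ker_mk']
  · apply GenLE.of_le_zpowers (a := QuotientGroup.mk' N a)
    refine (Subgroup.map_mono hM).trans ?_
    rw [Subgroup.map_sup, MonoidHom.map_zpowers, QuotientGroup.map_mk'_self, bot_sup_eq]

lemma GenLE.comm {C : Type*} [CommGroup C] (S : Finset C) :
    ∀ M : Subgroup C, M ≤ Subgroup.closure (S : Set C) → GenLE M S.card := by
  classical
  induction S using Finset.induction_on with
  | empty =>
    intro M hM
    exact ⟨∅, by simp, by simpa using hM.antisymm (by simp) |>.symm⟩
  | insert x S hx ih =>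
    intro M hM
    rw [Finset.card_insert_of_notMem hx]
    apply GenLE.cyc_ext (N := Subgroup.closure (S : Set C)) (a := x)
    · rwa [Finset.coe_insert, Set.insert_eq, Subgroup.closure_union, sup_comm,
        ← Subgroup.zpowers_eq_closure] at hM
    · exact ih _ inf_le_right

lemma GenLE.index {G : Type*} [Group G] {M N : Subgroup G} {d J : ℕ} (hNM : N ≤ M)
    (h0 : N.relIndex M ≠ 0) (hJ : N.relIndex M ≤ J) (h : GenLE N d) : GenLE M (d + J) := by
  classical
  obtain ⟨S, hS, hSc⟩ := h
  have hfin : Finite (M ⧸ N.subgroupOf M) := Nat.finite_of_card_ne_zero h0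
  have := Fintype.ofFinite (M ⧸ N.subgroupOf M)
  let g : M ⧸ N.subgroupOf M → G := fun q => (q.out : M)
  refine ⟨S ∪ Finset.univ.image g, ?_, ?_⟩
  · refine (Finset.card_union_le _ _).trans (Nat.add_le_add hS ?_)
    refine Finset.card_image_le.trans ?_
    rw [Finset.card_univ, ← Nat.card_eq_fintype_card]
    exact hJ
  · rw [Finset.coe_union, Subgroup.closure_union, hSc]
    apply le_antisymm
    · refine sup_le hNM ?_
      rw [Subgroup.closure_le]
      intro x hx
      simp only [Finset.coe_image, Finset.coe_univ, Set.image_univ, Set.mem_range] at hx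
      obtain ⟨q, rfl⟩ := hx
      exact q.out.2
    · intro x hx
      let q : M ⧸ N.subgroupOf M := QuotientGroup.mk ⟨x, hx⟩
      have h1 : (q.out : M)⁻¹ * ⟨x, hx⟩ ∈ N.subgroupOf M := by
        rw [← QuotientGroup.eq, QuotientGroup.out_eq']
      have h2 : (g q)⁻¹ * x ∈ N := h1
      have h3 : g q ∈ Subgroup.closure ((Finset.univ.image g : Finset G) : Set G) :=
        Subgroup.subset_closure (by simp)
      have := Subgroup.mul_mem _ (Subgroup.mem_sup_right (S := N) h3) (Subgroup.mem_sup_left h2)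
      simpa using this

lemma normalCore_index_le {G : Type*} [Group G] (A : Subgroup G) (h0 : A.index ≠ 0) :
    A.normalCore.index ≤ (A.index).factorial := by
  have hfin : A.FiniteIndex := ⟨h0⟩
  apply Nat.le_of_dvd (Nat.factorial_pos _)
  rw [Subgroup.normalCore_eq_ker, Subgroup.index_ker, Subgroup.index_eq_card, ← Nat.card_perm]
  exact Subgroup.card_subgroup_dvd_card _

lemma finite_lift (Gt : Subgroup (GL (Fin 2) ℂ)) (L : Finset (GL (Fin 2) ℂ))
    (hL : ∀ g ∈ Gt, ∃ l ∈ L, ∃ c : ℂˣ, g = GeneralLinearGroup.scalar (Fin 2) c * l) :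
    ∃ H : Subgroup (GL (Fin 2) ℂ), Finite H ∧ (∀ h ∈ H, h.val.det = 1) ∧
      Gt ≤ H ⊔ Subgroup.center (GL (Fin 2) ℂ) := by
  let Z := Subgroup.center (GL (Fin 2) ℂ)
  let H : Subgroup (GL (Fin 2) ℂ) := (GeneralLinearGroup.det).ker ⊓ (Gt ⊔ Z)
  have hdet : ∀ h : GL (Fin 2) ℂ, h ∈ (GeneralLinearGroup.det (n := Fin 2) (R := ℂ)).ker ↔
      h.val.det = 1 := by
    intro h
    rw [MonoidHom.mem_ker, Units.ext_iff]; rfl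
  refine ⟨H, ?_, fun h hh => (hdet h).mp hh.1, ?_⟩
  · have hsub : (H : Set (GL (Fin 2) ℂ)) ⊆ ⋃ l ∈ L,
        (fun c : ℂˣ => GeneralLinearGroup.scalar (Fin 2) c * l) ''
          {c : ℂˣ | c ^ 2 * GeneralLinearGroup.det l = 1} := by
      intro h hh
      obtain ⟨h1, h2⟩ := hh
      obtain ⟨g, hg, z, hz, rfl⟩ := Subgroup.mem_sup_of_normal_right.mp h2
      obtain ⟨l, hl, c, rfl⟩ := hL g hg
      rw [show Z = _ from GeneralLinearGroup.center_eq_range_scalar] at hz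
      obtain ⟨d, rfl⟩ := hz
      simp only [Set.mem_iUnion]
      have e : GeneralLinearGroup.scalar (Fin 2) c * l * GeneralLinearGroup.scalar (Fin 2) d =
          GeneralLinearGroup.scalar (Fin 2) (c * d) * l := by
        rw [mul_assoc, ← GeneralLinearGroup.scalar_commute, ← mul_assoc, map_mul]
      refine ⟨l, hl, c * d, ?_, e.symm⟩
      have h1' : GeneralLinearGroup.det _ = 1 := h1
      rw [e, map_mul, GeneralLinearGroup.det_scalar, Fintype.card_fin] at h1'
      exact h1'
    apply Set.Finite.subset _ hsub
    apply Set.Finite.biUnion L.finite_toSet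
    intro l _
    apply Set.Finite.image
    by_cases hne : ∃ c₀ : ℂˣ, c₀ ^ 2 * GeneralLinearGroup.det l = 1
    · obtain ⟨c₀, hc₀⟩ := hne
      apply Set.Finite.subset (Set.toFinite {c₀, -c₀})
      intro c hc
      have : c ^ 2 = c₀ ^ 2 := mul_right_cancel ((show _ = _ from hc).trans hc₀.symm)
      have h2 : (c : ℂ) ^ 2 = (c₀ : ℂ) ^ 2 := by exact_mod_cast congrArg Units.val this
      rcases sq_eq_sq_iff_eq_or_eq_neg.mp h2 with h | h
      · left; exact Units.ext h
      · right; exact Units.ext h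
    · push Not at hne
      convert Set.finite_empty
      ext c; simpa using hne c
  · intro g hg
    obtain ⟨c, hc⟩ := IsAlgClosed.exists_pow_nat_eq g.val.det (n := 2) (by norm_num)
    have hg0 : g.val.det ≠ 0 := by
      have := (GeneralLinearGroup.det g).ne_zero
      exact this
    have hc0 : c ≠ 0 := by rintro rfl; apply hg0; rw [← hc]; norm_num
    let u : ℂˣ := Units.mk0 c hc0
    let s := GeneralLinearGroup.scalar (Fin 2) u
    have hs : s ∈ Z := by
      rw [show Z = _ from GeneralLinearGroup.center_eq_range_scalar]; exact ⟨u, rfl⟩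
    have hu : GeneralLinearGroup.det g = u ^ 2 := by
      apply Units.ext
      simp only [Units.val_pow_eq_pow_val, u, Units.val_mk0, hc]; rfl
    have : g * s⁻¹ ∈ H := by
      refine ⟨?_, Subgroup.mul_mem _ (Subgroup.mem_sup_left hg)
        (Subgroup.mem_sup_right (Z.inv_mem hs))⟩
      change GeneralLinearGroup.det (g * s⁻¹) = 1
      rw [map_mul, map_inv, GeneralLinearGroup.det_scalar, Fintype.card_fin, hu, mul_inv_cancel]
    have := Subgroup.mul_mem _ (Subgroup.mem_sup_left (T := Z) this) (Subgroup.mem_sup_right hs)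
    simpa using this

lemma main_aux (Λ : Subgroup (GL (Fin 2) ℂ)) [Λ.Normal]
    (hcentral : Λ ≤ Subgroup.center (GL (Fin 2) ℂ)) (hfg : Group.FG Λ) :
    ∃ J R : ℕ, ∀ G : Subgroup (GL (Fin 2) ℂ ⧸ Λ), Finite G →
      (∃ A : Subgroup G, A.Normal ∧ (∀ x y : A, x * y = y * x) ∧ A.index ≤ J) ∧ GenLE G R := by
  classical
  obtain ⟨J, hJ⟩ := key_GL
  let sc : ℂˣ →* GL (Fin 2) ℂ := GeneralLinearGroup.scalar (Fin 2)
  have hsc : Function.Injective sc := by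
    intro x y hxy
    have := congrArg (fun g : GL (Fin 2) ℂ => g.val 0 0) hxy
    apply Units.ext
    simpa [sc, GeneralLinearGroup.coe_scalar] using this
  let Z := Subgroup.center (GL (Fin 2) ℂ)
  have hZ : Z = sc.range := GeneralLinearGroup.center_eq_range_scalar
  let mk := QuotientGroup.mk' Λ
  have hmk : Function.Surjective mk := QuotientGroup.mk'_surjective Λ
  obtain ⟨S₀, hS₀⟩ : ∃ S₀ : Finset ℂˣ, Subgroup.closure (S₀ : Set ℂˣ) = Λ.comap sc := by
    have hm : (Λ.comap sc).map sc = Λ := by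
      rw [Subgroup.map_comap_eq, ← hZ]; exact inf_eq_right.mpr hcentral
    have e := (Λ.comap sc).equivMapOfInjective sc hsc
    rw [hm] at e
    have : Group.FG (Λ.comap sc) := Group.fg_of_surjective (f := e.symm.toMonoidHom) e.symm.surjective
    exact (Group.fg_iff_subgroup_fg _).mp this
  refine ⟨J.factorial, (S₀.card + 1) + 1 + J, fun G hG => ?_⟩
  let Gt := G.comap mk
  have hGt : Gt.map mk = G := Subgroup.map_comap_eq_self_of_surjective hmk G
  have := Fintype.ofFinite G
  obtain ⟨H, hHfin, hHdet, hGH⟩ := finite_lift Gt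
    (Finset.univ.image fun x : G => (x : GL (Fin 2) ℂ ⧸ Λ).out) (by
      intro g hg
      refine ⟨(mk g).out, Finset.mem_image.mpr ⟨⟨mk g, hg⟩, Finset.mem_univ _, rfl⟩, ?_⟩
      have h1 : ((mk g).out)⁻¹ * g ∈ Λ := by
        rw [← QuotientGroup.eq, QuotientGroup.out_eq']; rfl
      have h2 := hcentral h1
      have h3 := h2
      change _ ∈ Z at h3
      rw [hZ] at h3
      obtain ⟨c, hc⟩ := h3
      refine ⟨c, ?_⟩
      change g = sc c * _
      rw [hc, ← Subgroup.mem_center_iff.mp h2, mul_inv_cancel_left])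
  obtain ⟨a, haH, ha⟩ := hJ H hHfin hHdet
  let ZA := Z ⊔ Subgroup.zpowers a
  have hi0 : (Subgroup.zpowers a).relIndex H ≠ 0 := by
    intro h
    have := Subgroup.relIndex_dvd_card (Subgroup.zpowers a) H
    rw [h, zero_dvd_iff] at this
    exact Nat.card_pos.ne' this
  have hZAH : ZA.relIndex (H ⊔ Z) = ZA.relIndex H := by
    have h1 := Subgroup.relIndex_map_map (QuotientGroup.mk' Z) ZA H
    rw [← Subgroup.relIndex_comap, Subgroup.comap_map_eq, QuotientGroup.ker_mk',
      sup_eq_left.mpr (le_sup_left : Z ≤ ZA)] at h1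
    exact h1.symm
  have hd : ZA.relIndex H ∣ (Subgroup.zpowers a).relIndex H :=
    Subgroup.relIndex_dvd_of_le_left _ le_sup_right
  have hH0 : ZA.relIndex H ≠ 0 := ne_zero_of_dvd_ne_zero hi0 hd
  have hHJ : ZA.relIndex H ≤ J := (Nat.le_of_dvd (Nat.pos_of_ne_zero hi0) hd).trans ha
  have hG0 : ZA.relIndex Gt ≠ 0 := fun h =>
    (hZAH ▸ hH0) (Subgroup.relIndex_eq_zero_of_le_right hGH h)
  have hGJ : ZA.relIndex Gt ≤ J :=
    (Subgroup.relIndex_le_of_le_right hGH (hZAH ▸ hH0)).trans (hZAH ▸ hHJ)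
  have hcommZA : ∀ x ∈ ZA, ∀ y ∈ ZA, x * y = y * x := by
    intro x hx y hy
    obtain ⟨z, hz, b, ⟨k, rfl⟩, rfl⟩ := Subgroup.mem_sup_of_normal_left.mp hx
    obtain ⟨z', hz', b', ⟨k', rfl⟩, rfl⟩ := Subgroup.mem_sup_of_normal_left.mp hy
    have c1 : ∀ g, Commute g z := fun g => Subgroup.mem_center_iff.mp hz g
    have c2 : ∀ g, Commute g z' := fun g => Subgroup.mem_center_iff.mp hz' g
    have c3 : Commute (a ^ k) (a ^ k') := (Commute.refl a).zpow_zpow k k'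
    exact ((c1 _).symm.mul_left ((c2 _).mul_right c3))
  constructor
  · let A : Subgroup G := (ZA.map mk).subgroupOf G
    have hAi : A.index = ((ZA.map mk).comap mk).relIndex Gt := by
      rw [Subgroup.relIndex_comap, hGt]; rfl
    have hAd : A.index ∣ ZA.relIndex Gt := by
      rw [hAi]; exact Subgroup.relIndex_dvd_of_le_left _ (Subgroup.le_comap_map _ _)
    have hA0 : A.index ≠ 0 := ne_zero_of_dvd_ne_zero hG0 hAd
    have hAJ : A.index ≤ J := (Nat.le_of_dvd (Nat.pos_of_ne_zero hG0) hAd).trans hGJ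
    refine ⟨A.normalCore, inferInstance, ?_,
      (normalCore_index_le A hA0).trans (Nat.factorial_le hAJ)⟩
    intro x y
    have hx : ((x : G) : GL (Fin 2) ℂ ⧸ Λ) ∈ ZA.map mk := A.normalCore_le x.2
    have hy : ((y : G) : GL (Fin 2) ℂ ⧸ Λ) ∈ ZA.map mk := A.normalCore_le y.2
    obtain ⟨x', hx', ex⟩ := hx
    obtain ⟨y', hy', ey⟩ := hy
    apply Subtype.ext
    apply Subtype.ext
    simp only [Subgroup.coe_mul]
    rw [← ex, ← ey, ← map_mul, ← map_mul, hcommZA x' hx' y' hy']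
  · rw [← hGt]
    apply GenLE.map
    have hK : GenLE (Gt.comap sc) (1 + S₀.card) := by
      apply GenLE.ext (powMonoidHom (Nat.card G))
      · have hn : Nat.card G ≠ 0 := Nat.card_pos.ne'
        have : NeZero (Nat.card G) := ⟨hn⟩
        obtain ⟨ζ, hζ⟩ := (Subgroup.isCyclic_iff_exists_zpowers_eq_top
          (rootsOfUnity (Nat.card G) ℂ)).mp inferInstance
        apply GenLE.of_le_zpowers (a := ζ)
        rw [hζ]
        intro x hx
        have : powMonoidHom (Nat.card G) x = 1 := hx.2
        rw [mem_rootsOfUnity]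
        simpa using this
      · apply GenLE.comm
        rw [hS₀]
        rintro _ ⟨x, hx, rfl⟩
        have hx' : mk (sc x) ∈ G := hx
        have h1 : mk (sc x) ^ Nat.card G = 1 := by
          have := pow_card_eq_one' (x := (⟨_, hx'⟩ : G))
          exact congrArg Subtype.val this
        rw [← map_pow, ← map_pow] at h1
        exact (QuotientGroup.eq_one_iff (sc (x ^ Nat.card G))).mp h1
    have hK' : GenLE (Gt ⊓ Z) (S₀.card + 1) := by
      have := hK.map sc
      rw [Subgroup.map_comap_eq, ← hZ, inf_comm, add_comm] at this
      exact this
    have hM : GenLE (ZA ⊓ Gt) (S₀.card + 1 + 1) := by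
      apply GenLE.cyc_ext (N := Z) (a := a) inf_le_left
      have : ZA ⊓ Gt ⊓ Z = Gt ⊓ Z := by
        rw [inf_assoc]
        exact inf_eq_right.mpr (inf_le_right.trans le_sup_left)
      rwa [this]
    exact GenLE.index inf_le_right (by rwa [Subgroup.inf_relIndex_right])
      (by rwa [Subgroup.inf_relIndex_right]) hM

/-- Lemma 2.7: if Λ is a finitely generated central subgroup of GL₂(ℂ), then the
quotient group GL₂(ℂ)/Λ is strongly Jordan. -/
theorem stmt_4 (Λ : Subgroup (GL (Fin 2) ℂ))
    (hcentral : Λ ≤ Subgroup.center (GL (Fin 2) ℂ)) (hfg : Group.FG Λ) :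
    letI : Λ.Normal :=
      ⟨fun n hn g => by
        have h : g * n * g⁻¹ = n := by
          rw [Subgroup.mem_center_iff.mp (hcentral hn) g, mul_assoc, mul_inv_cancel,
            mul_one]
        rw [h]; exact hn⟩
    IsStronglyJordanGroup (GL (Fin 2) ℂ ⧸ Λ) := by
  have : Λ.Normal := ⟨fun n hn g => by
    have h : g * n * g⁻¹ = n := by
      rw [Subgroup.mem_center_iff.mp (hcentral hn) g, mul_assoc, mul_inv_cancel, mul_one]
    rw [h]; exact hn⟩
  obtain ⟨J, R, h⟩ := main_aux Λ hcentral hfg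
  exact ⟨⟨J, fun G hG => (h G hG).1⟩, R, fun G hG => (h G hG).2⟩
end

section
/- Let M ∈ GL₃(ℤ) have no eigenvalue equal to 1 and at least one eigenvalue that is not a root of unity, and let Γ = ℤ³ ⋊ ℤ be the semidirect product defined by M. Then there exists a constant ν = ν(Γ) with the following property: whenever Γ̂ = ℤ³ ⋊ ℤ is a semidirect product defined by some matrix in GL₃(ℤ) and Γ̂ contains Γ as a normal subgroup, the quotient group G = Γ̂/Γ is finite and has a normal abelian subgroup of index at most ν. -/
open Matrix

/-- The multiplicative automorphism of ℤ³ (written multiplicatively) induced by a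
matrix in GL₃(ℤ), acting by matrix-vector multiplication. -/
def glMulAut {n : ℕ} (M : GL (Fin n) ℤ) : MulAut (Multiplicative (Fin n → ℤ)) :=
  AddEquiv.toMultiplicative
    ((LinearMap.GeneralLinearGroup.generalLinearEquiv ℤ (Fin n → ℤ)
        (Matrix.GeneralLinearGroup.toLin M)).toAddEquiv)

/-- The semidirect product ℤ³ ⋊ ℤ in which the generator of ℤ acts on ℤ³ by the
matrix M ∈ GL₃(ℤ). -/
abbrev sdpZ3 (M : GL (Fin 3) ℤ) : Type :=
  SemidirectProduct (Multiplicative (Fin 3 → ℤ)) (Multiplicative ℤ)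
    (zpowersHom _ (glMulAut M))

theorem pow_bound (M : GL (Fin 3) ℤ)
    (h2 : ∃ μ : ℂ, (((M : Matrix (Fin 3) (Fin 3) ℤ).map ((↑) : ℤ → ℂ)).charpoly).IsRoot μ ∧
      ¬ ∃ k : ℕ, 0 < k ∧ μ ^ k = 1) :
    ∃ ν : ℕ, ∀ (B : Matrix (Fin 3) (Fin 3) ℤ) (k : ℕ), 0 < k →
      B ^ k = (M : Matrix (Fin 3) (Fin 3) ℤ) → k ≤ ν := by
  classical
  obtain ⟨μ, hμ, hμ1⟩ := h2
  set Mc : Matrix (Fin 3) (Fin 3) ℂ := (M : Matrix (Fin 3) (Fin 3) ℤ).map ((↑) : ℤ → ℂ) with hMc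
  have hMc' : Mc = (Int.castRingHom ℂ).mapMatrix (M : Matrix (Fin 3) (Fin 3) ℤ) := rfl
  rw [← Matrix.mem_spectrum_iff_isRoot_charpoly] at hμ
  have hμ0 : μ ≠ 0 := by
    rintro rfl
    rw [spectrum.zero_mem_iff] at hμ
    apply hμ
    rw [hMc']
    exact M.isUnit.map _
  obtain ⟨C, hC⟩ : ∃ C : ℝ, ∀ z ∈ spectrum ℂ Mc, ‖z‖ ≤ C := by
    have hf : (spectrum ℂ Mc).Finite := by
      refine (Mc.charpoly.roots.toFinset.finite_toSet).subset ?_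
      intro z hz
      rw [Matrix.mem_spectrum_iff_isRoot_charpoly] at hz
      simpa [(Matrix.charpoly_monic Mc).ne_zero] using hz
    obtain ⟨C, hC⟩ := (hf.image (fun z => ‖z‖)).bddAbove
    exact ⟨C, fun z hz => hC ⟨z, hz, rfl⟩⟩
  set D : ℝ := max (max C 1) 1 ^ 3 * (Nat.choose 3 (3 / 2) : ℕ) with hD
  set T : Set ℂ := (⋃ (f : Polynomial ℤ) (_ : f.natDegree ≤ 3 ∧ ∀ i, f.coeff i ∈ Set.Icc (-⌈D⌉) ⌈D⌉),
        (((f.map (Int.castRingHom ℂ)).roots.toFinset : Finset ℂ) : Set ℂ)) with hT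
  have hTf : T.Finite := Polynomial.bUnion_roots_finite (Int.castRingHom ℂ) 3 (Set.finite_Icc _ _)
  have hS : (⋃ β ∈ T, {k : ℕ | 0 < k ∧ β ^ k = μ}).Finite := by
    refine hTf.biUnion fun β _ => Set.Subsingleton.finite ?_
    have key : ∀ k l : ℕ, 0 < k → β ^ k = μ → β ^ l = μ → k < l → False := by
      intro k l hk hk' hl hlt
      have hβ : β ≠ 0 := by
        rintro rfl
        rw [zero_pow hk.ne'] at hk'
        exact hμ0 hk'.symm
      apply hμ1
      refine ⟨l - k, by omega, ?_⟩
      have h3 : β ^ (l - k) = 1 := by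
        have : β ^ k * β ^ (l - k) = β ^ k * 1 := by
          rw [← pow_add, mul_one, hk', ← hl]; congr 1; omega
        exact mul_left_cancel₀ (pow_ne_zero _ hβ) this
      rw [← hk', ← pow_mul, mul_comm, pow_mul, h3, one_pow]
    rintro k ⟨hk, hk'⟩ l ⟨hl, hl'⟩
    rcases lt_trichotomy k l with h | h | h
    · exact (key k l hk hk' hl' h).elim
    · exact h
    · exact (key l k hl hl' hk' h).elim
  obtain ⟨ν, hν⟩ := hS.bddAbove
  refine ⟨ν, fun B k hk hB => hν ?_⟩
  set Bc : Matrix (Fin 3) (Fin 3) ℂ := (Int.castRingHom ℂ).mapMatrix B with hBc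
  have hpow : Bc ^ k = Mc := by rw [hMc', ← hB, map_pow]
  have hsp := spectrum.map_pow_of_pos (𝕜 := ℂ) Bc hk
  rw [hpow] at hsp
  have hchar : B.charpoly.map (Int.castRingHom ℂ) = Bc.charpoly := by
    rw [hBc, RingHom.mapMatrix_apply, Matrix.charpoly_map]
  have hbd : ∀ z ∈ (B.charpoly.map (Int.castRingHom ℂ)).roots, ‖z‖ ≤ max C 1 := by
    intro z hz
    rw [hchar, Polynomial.mem_roots (Matrix.charpoly_monic Bc).ne_zero,
      ← Matrix.mem_spectrum_iff_isRoot_charpoly] at hz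
    have h1 : ‖z ^ k‖ ≤ C := hC _ (hsp ▸ ⟨z, hz, rfl⟩)
    rw [norm_pow] at h1
    rcases le_or_gt ‖z‖ 1 with h | h
    · exact h.trans (le_max_right _ _)
    · exact ((le_self_pow₀ h.le hk.ne').trans h1).trans (le_max_left _ _)
  have hdeg : B.charpoly.natDegree ≤ 3 := by
    rw [Matrix.charpoly_natDegree_eq_dim]; simp
  have hμ' := hμ
  rw [hsp] at hμ'
  obtain ⟨β, hβ, hβk⟩ := hμ'
  refine Set.mem_biUnion (x := β) ?_ ⟨hk, hβk⟩
  rw [hT]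
  simp only [Set.mem_iUnion]
  refine ⟨B.charpoly, ⟨hdeg, fun i => ?_⟩, ?_⟩
  · have := Polynomial.coeff_bdd_of_roots_le (Int.castRingHom ℂ) (Matrix.charpoly_monic B)
      (IsAlgClosed.splits _) hdeg hbd i
    rw [Polynomial.coeff_map, eq_intCast, Complex.norm_intCast] at this
    have h4 : ((|B.charpoly.coeff i| : ℤ) : ℝ) ≤ (⌈D⌉ : ℤ) := by
      push_cast
      exact this.trans (Int.le_ceil D)
    rw [Set.mem_Icc, ← abs_le]
    exact_mod_cast h4
  · rw [hchar]
    rw [Matrix.mem_spectrum_iff_isRoot_charpoly] at hβ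
    simpa [(Matrix.charpoly_monic Bc).ne_zero] using hβ

theorem det_sub_one (M : GL (Fin 3) ℤ)
    (h1 : ¬ (((M : Matrix (Fin 3) (Fin 3) ℤ).map ((↑) : ℤ → ℂ)).charpoly).IsRoot 1) :
    ((M : Matrix (Fin 3) (Fin 3) ℤ) - 1).det ≠ 0 := by
  intro h
  apply h1
  have h3 : (M : Matrix (Fin 3) (Fin 3) ℤ).charpoly.eval 1 = 0 := by
    rw [Matrix.eval_charpoly, map_one, ← neg_sub, Matrix.det_neg, h, mul_zero]
  have : (M : Matrix (Fin 3) (Fin 3) ℤ).map ((↑) : ℤ → ℂ)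
    = (M : Matrix (Fin 3) (Fin 3) ℤ).map (Int.castRingHom ℂ) := rfl
  rw [this, Matrix.charpoly_map, Polynomial.IsRoot.def, Polynomial.eval_map, Polynomial.eval₂_at_one,
    h3, map_zero]

theorem hom_trivial (M : Matrix (Fin 3) (Fin 3) ℤ) (hM : (M - 1).det ≠ 0)
    (f : (Fin 3 → ℤ) →+ ℤ) (hf : ∀ v, f (M *ᵥ v) = f v) (v : Fin 3 → ℤ) : f v = 0 := by
  have h : (M - 1) *ᵥ ((M - 1).adjugate *ᵥ v) = (M - 1).det • v := by
    rw [Matrix.mulVec_mulVec, Matrix.mul_adjugate, Matrix.smul_mulVec, Matrix.one_mulVec]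
  have h2 : f ((M - 1) *ᵥ ((M - 1).adjugate *ᵥ v)) = 0 := by
    rw [Matrix.sub_mulVec, Matrix.one_mulVec, map_sub, hf, sub_self]
  rw [h, map_zsmul, smul_eq_mul] at h2
  exact (mul_eq_zero.mp h2).resolve_left hM

theorem finite_index_of_inj (p : Multiplicative (Fin 3 → ℤ) →* Multiplicative (Fin 3 → ℤ))
    (hp : Function.Injective p) : p.range.index ≠ 0 := by
  let P : (Fin 3 → ℤ) →ₗ[ℤ] (Fin 3 → ℤ) := (MonoidHom.toAdditive p).toIntLinearMap
  have hP : Function.Injective P := hp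
  have : Finite ((Fin 3 → ℤ) ⧸ LinearMap.range P) := by
    apply Submodule.finiteQuotientOfFreeOfRankEq
    exact LinearMap.finrank_range_of_inj hP
  have h : (LinearMap.range P).toAddSubgroup.index ≠ 0 := by
    have : Finite ((Fin 3 → ℤ) ⧸ (LinearMap.range P).toAddSubgroup) := this
    have := AddSubgroup.finiteIndex_iff_finite_quotient.mpr this
    exact this.index_ne_zero
  exact h

theorem exists_root (M : GL (Fin 3) ℤ)
    (p : Multiplicative (Fin 3 → ℤ) →* Multiplicative (Fin 3 → ℤ))
    (hp : Function.Injective p) (σ : MulAut (Multiplicative (Fin 3 → ℤ))) (k : ℕ)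
    (hσ : ∀ v, ∃ w, p w = σ (p v)) (hk : ∀ v, p (glMulAut M v) = (σ ^ k) (p v)) :
    ∃ B : Matrix (Fin 3) (Fin 3) ℤ, B ^ k = (M : Matrix (Fin 3) (Fin 3) ℤ) := by
  choose b hb using hσ
  let b' : Multiplicative (Fin 3 → ℤ) →* Multiplicative (Fin 3 → ℤ) := MonoidHom.mk' b (by
    intro x y
    apply hp
    rw [hb, map_mul, map_mul, map_mul, hb, hb])
  let L : (Fin 3 → ℤ) →ₗ[ℤ] (Fin 3 → ℤ) := (MonoidHom.toAdditive b').toIntLinearMap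
  have hL : ∀ (j : ℕ) (v : Fin 3 → ℤ),
      p (Multiplicative.ofAdd ((L ^ j) v)) = (σ ^ j) (p (Multiplicative.ofAdd v)) := by
    intro j
    induction j with
    | zero => intro v; simp
    | succ j ih =>
      intro v
      rw [pow_succ', pow_succ', MulAut.mul_apply, ← ih]
      exact hb _
  have hLM : L ^ k = Matrix.toLin' (M : Matrix (Fin 3) (Fin 3) ℤ) := by
    apply LinearMap.ext
    intro v
    have := (hL k v).trans (hk (Multiplicative.ofAdd v)).symm
    exact hp this
  refine ⟨LinearMap.toMatrix' L, ?_⟩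
  have h5 : LinearMap.toMatrix' (L ^ k) = (LinearMap.toMatrix' L) ^ k :=
    map_pow (LinearMap.toMatrixAlgEquiv' (R := ℤ) (n := Fin 3)) L k
  rw [← h5, hLM, LinearMap.toMatrix'_toLin']

open SemidirectProduct in
/-- Lemma A.5: let M ∈ GL₃(ℤ) have no eigenvalue equal to 1 and at least one
eigenvalue that is not a root of unity, and let Γ = ℤ³ ⋊ ℤ be the semidirect product
defined by M. Then there is a constant ν = ν(Γ) such that whenever a semidirect
product Γ̂ = ℤ³ ⋊ ℤ (defined by some matrix in GL₃(ℤ)) contains Γ as a normal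
subgroup, the quotient G = Γ̂/Γ is finite and has a normal abelian subgroup of index
at most ν. -/
theorem stmt_11 (M : GL (Fin 3) ℤ)
    (h1 : ¬ (((M : Matrix (Fin 3) (Fin 3) ℤ).map ((↑) : ℤ → ℂ)).charpoly).IsRoot 1)
    (h2 : ∃ μ : ℂ, (((M : Matrix (Fin 3) (Fin 3) ℤ).map ((↑) : ℤ → ℂ)).charpoly).IsRoot μ ∧
      ¬ ∃ k : ℕ, 0 < k ∧ μ ^ k = 1) :
    ∃ ν : ℕ, ∀ (M' : GL (Fin 3) ℤ) (K : Subgroup (sdpZ3 M')) [K.Normal],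
      Nonempty (sdpZ3 M ≃* K) →
        Finite (sdpZ3 M' ⧸ K) ∧
        ∃ A : Subgroup (sdpZ3 M' ⧸ K), A.Normal ∧ (∀ x y : A, x * y = y * x) ∧
          A.index ≤ ν := by
  obtain ⟨ν, hν⟩ := pow_bound M h2
  have hdet := det_sub_one M h1
  refine ⟨ν, fun M' K hK ⟨e⟩ => ?_⟩
  let ι : sdpZ3 M →* sdpZ3 M' := K.subtype.comp e.toMonoidHom
  have hι : Function.Injective ι := K.subtype_injective.comp e.injective
  have hιK : ∀ x, ι x ∈ K := fun x => (e x).2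
  have hKι : ∀ y ∈ K, ∃ x, ι x = y := fun y hy => ⟨e.symm ⟨y, hy⟩, by simp [ι]⟩
  let ψ : sdpZ3 M →* Multiplicative ℤ := rightHom.comp ι
  let t : sdpZ3 M := inr (Multiplicative.ofAdd 1)
  have hconj : ∀ v : Multiplicative (Fin 3 → ℤ),
      (inl (glMulAut M v) : sdpZ3 M) = t * inl v * t⁻¹ := by
    intro v
    have := inl_aut (φ := zpowersHom _ (glMulAut M)) (Multiplicative.ofAdd 1) v
    simpa [t] using this
  have hψ : ∀ v, ψ (inl v) = 1 := by
    let f : (Fin 3 → ℤ) →+ ℤ := MonoidHom.toAdditive (ψ.comp inl)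
    intro v
    refine hom_trivial (M : Matrix (Fin 3) (Fin 3) ℤ) hdet f ?_ (Multiplicative.toAdd v)
    intro w
    have h := congrArg ψ (hconj (Multiplicative.ofAdd w))
    rw [map_mul, map_mul, map_inv, mul_comm, inv_mul_cancel_left] at h
    exact h
  -- the embedding of lattices
  have hleft : ∀ g : sdpZ3 M', rightHom g = 1 → (inl g.left : sdpZ3 M') = g := by
    intro g hg
    ext1
    · simp
    · simpa using hg.symm
  let p : Multiplicative (Fin 3 → ℤ) →* Multiplicative (Fin 3 → ℤ) :=
    MonoidHom.mk' (fun v => (ι (inl v)).left) (by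
      intro x y
      apply inl_injective (φ := zpowersHom _ (glMulAut M'))
      refine (hleft _ (hψ (x * y))).trans ?_
      refine Eq.trans ?_ (map_mul inl _ _).symm
      rw [hleft _ (hψ x), hleft _ (hψ y), map_mul, map_mul])
  have hpι : ∀ v, (inl (p v) : sdpZ3 M') = ι (inl v) := fun v => hleft _ (hψ v)
  have hp : Function.Injective p := by
    intro x y hxy
    apply inl_injective (φ := zpowersHom _ (glMulAut M))
    apply hι
    rw [← hpι, ← hpι, hxy]
  set n : ℤ := Multiplicative.toAdd (ψ t) with hn
  have hψx : ∀ x : sdpZ3 M, Multiplicative.toAdd (ψ x) = Multiplicative.toAdd x.right * n := by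
    intro x
    have hx : x = inl x.left * t ^ (Multiplicative.toAdd x.right) := by
      conv_lhs => rw [← inl_left_mul_inr_right x]
      congr 1
      rw [← map_zpow, ← ofAdd_zsmul]
      simp
    conv_lhs => rw [hx, map_mul, hψ, one_mul, map_zpow]
    rw [toAdd_zpow, smul_eq_mul]
  have hn0 : n ≠ 0 := by
    intro h0
    have hψ1 : ∀ x, ψ x = 1 := by
      intro x
      have := hψx x
      rw [h0, mul_zero] at this
      exact this
    have hcomm : ∀ x y : sdpZ3 M, x * y = y * x := by
      intro x y
      apply hι
      rw [map_mul, map_mul, ← hleft _ (hψ1 x), ← hleft _ (hψ1 y), ← map_mul, ← map_mul, mul_comm]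
    apply hdet
    have : (M : Matrix (Fin 3) (Fin 3) ℤ) = 1 := by
      apply Matrix.toLin'.injective
      apply LinearMap.ext
      intro v
      have h := hconj (Multiplicative.ofAdd v)
      rw [hcomm t, mul_inv_cancel_right] at h
      have h' := inl_injective h
      simpa using (show (M : Matrix (Fin 3) (Fin 3) ℤ) *ᵥ v = v from h')
    rw [this, sub_self, Matrix.det_zero]
  -- intersection of `K` with the lattice
  have hinter : ∀ w, (inl w : sdpZ3 M') ∈ K → ∃ v, p v = w := by
    intro w hw
    obtain ⟨x, hx⟩ := hKι _ hw
    have h3 : ψ x = 1 := by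
      change rightHom (ι x) = 1
      rw [hx]; simp
    have h4 := hψx x
    rw [h3, toAdd_one, eq_comm, mul_eq_zero] at h4
    have h5 : x.right = 1 := h4.resolve_right hn0
    refine ⟨x.left, ?_⟩
    apply inl_injective (φ := zpowersHom _ (glMulAut M'))
    rw [hpι, ← hx]
    congr 1
    ext1
    · simp
    · simp [h5]
  -- action
  have hinv : ∀ (j : Multiplicative ℤ) v, ∃ w, p w = (zpowersHom _ (glMulAut M') j) (p v) := by
    intro j v
    apply hinter
    rw [inl_aut, hpι, map_inv]
    exact hK.conj_mem _ (hιK _) _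
  have hact : ∀ v, p (glMulAut M v) = (glMulAut M' ^ n) (p v) := by
    intro v
    apply inl_injective (φ := zpowersHom _ (glMulAut M'))
    have h6 : (glMulAut M' ^ n) = zpowersHom _ (glMulAut M') (ψ t) := by
      rw [zpowersHom_apply]
    rw [hpι, hconj, h6, inl_aut, map_mul, map_mul, map_inv, ← hpι]
    have h7 : ι t = inl (ι t).left * inr (ψ t) := (inl_left_mul_inr_right (ι t)).symm
    rw [h7, _root_.mul_inv_rev, map_inv]
    have h8 : (inr (ψ t) * inl (p v) * (inr (ψ t))⁻¹ : sdpZ3 M')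
        = inl ((zpowersHom _ (glMulAut M') (ψ t)) (p v)) := by
      rw [inl_aut, map_inv]
    calc _ = (inl (ι t).left : sdpZ3 M') * (inr (ψ t) * inl (p v) * (inr (ψ t))⁻¹)
          * (inl (ι t).left)⁻¹ := by simp only [mul_assoc]
      _ = _ := by
        rw [h8, ← map_mul, ← map_inv, ← map_mul, mul_comm, inv_mul_cancel_left]
  have hnν : n.natAbs ≤ ν := by
    have hpos : 0 < n.natAbs := Int.natAbs_pos.mpr hn0
    have hσ : ∀ v, ∃ w, p w = (glMulAut M' ^ n.sign) (p v) := by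
      intro v
      have := hinv (Multiplicative.ofAdd n.sign) v
      simpa using this
    obtain ⟨B, hB⟩ := exists_root M p hp (glMulAut M' ^ n.sign) n.natAbs hσ (by
      intro v
      rw [← zpow_natCast, ← _root_.zpow_mul, Int.sign_mul_natAbs, hact])
    exact hν B _ hpos hB
  -- indices
  let N' : Subgroup (sdpZ3 M') := (rightHom : sdpZ3 M' →* Multiplicative ℤ).ker
  have hidx : (K.map (rightHom : sdpZ3 M' →* Multiplicative ℤ)).index = (K ⊔ N').index := by
    rw [Subgroup.index_map, MonoidHom.range_eq_top.mpr rightHom_surjective, Subgroup.index_top,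
      mul_one]
  have hz : (Subgroup.zpowers (ψ t)).index = n.natAbs := Int.index_zmultiples n
  have hle : Subgroup.zpowers (ψ t) ≤ K.map (rightHom : sdpZ3 M' →* Multiplicative ℤ) := by
    rw [Subgroup.zpowers_le]
    exact ⟨ι t, hιK t, rfl⟩
  have hdvd := Subgroup.index_dvd_of_le hle
  rw [hz, hidx] at hdvd
  have hpos : 0 < n.natAbs := Int.natAbs_pos.mpr hn0
  have hidx_le : (K ⊔ N').index ≤ ν := (Nat.le_of_dvd hpos hdvd).trans hnν
  have hidx_ne : (K ⊔ N').index ≠ 0 := fun h => by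
    rw [h, zero_dvd_iff] at hdvd; omega
  have hrel : K.relIndex N' ≠ 0 := by
    have h9 : N' = (inl : _ →* sdpZ3 M').range := range_inl_eq_ker_rightHom.symm
    rw [h9, ← Subgroup.index_comap]
    have h10 : p.range ≤ K.comap (inl : _ →* sdpZ3 M') := by
      rintro _ ⟨v, rfl⟩
      rw [Subgroup.mem_comap, hpι]
      exact hιK _
    intro h
    have h11 := Subgroup.index_dvd_of_le h10
    rw [h, zero_dvd_iff] at h11
    exact finite_index_of_inj p hp h11
  constructor
  · rw [← Subgroup.finiteIndex_iff_finite_quotient]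
    refine ⟨?_⟩
    rw [← Subgroup.relIndex_mul_index (le_sup_left : K ≤ K ⊔ N'), Subgroup.relIndex_sup_left]
    exact mul_ne_zero hrel hidx_ne
  · refine ⟨N'.map (QuotientGroup.mk' K), ?_, ?_, ?_⟩
    · exact Subgroup.Normal.map inferInstance _ (QuotientGroup.mk'_surjective K)
    · rintro ⟨_, x, hx, rfl⟩ ⟨_, y, hy, rfl⟩
      apply Subtype.ext
      change QuotientGroup.mk' K x * QuotientGroup.mk' K y
        = QuotientGroup.mk' K y * QuotientGroup.mk' K x
      rw [← hleft x hx, ← hleft y hy, ← map_mul, ← map_mul, ← map_mul, ← map_mul, mul_comm]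
    · rw [Subgroup.index_map, QuotientGroup.ker_mk',
        MonoidHom.range_eq_top.mpr (QuotientGroup.mk'_surjective K), Subgroup.index_top,
        mul_one, sup_comm]
      exact hidx_le
end

section
/- Let r be a positive integer and H(r) the discrete Heisenberg-type group with presentation ⟨δ₁, δ₂, δ₃ ∣ [δ₁,δ₃] = [δ₂,δ₃] = 1, [δ₁,δ₂] = δ₃^r⟩. Then every subgroup of finite index in H(r) is isomorphic to H(r') for some positive integer r', and every subgroup of infinite index in H(r) is abelian. -/
/-- The "discrete Heisenberg group" H(r): the group with presentation
⟨δ₁, δ₂, δ₃ ∣ [δ₁,δ₃] = [δ₂,δ₃] = 1, [δ₁,δ₂] = δ₃^r⟩, realized concretely as the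
group of upper unitriangular 3×3 rational matrices with (1,2)-entry `a ∈ ℤ`,
(2,3)-entry `b ∈ ℤ` and (1,3)-entry `c/r` with `c ∈ ℤ`; the element ⟨a, b, c⟩
corresponds to δ₁^a δ₂^b (δ₃-part c), with δ₁ = ⟨1,0,0⟩, δ₂ = ⟨0,1,0⟩,
δ₃ = ⟨0,0,1⟩. -/
@[ext]
structure Heis (r : ℕ) : Type where
  a : ℤ
  b : ℤ
  c : ℤ

namespace Heis

variable {r : ℕ}

instance : Mul (Heis r) :=
  ⟨fun x y => ⟨x.a + y.a, x.b + y.b, x.c + y.c + r * x.a * y.b⟩⟩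

instance : One (Heis r) := ⟨⟨0, 0, 0⟩⟩

instance : Inv (Heis r) :=
  ⟨fun x => ⟨-x.a, -x.b, -x.c + r * x.a * x.b⟩⟩

@[simp] lemma mul_a (x y : Heis r) : (x * y).a = x.a + y.a := rfl
@[simp] lemma mul_b (x y : Heis r) : (x * y).b = x.b + y.b := rfl
@[simp] lemma mul_c (x y : Heis r) : (x * y).c = x.c + y.c + r * x.a * y.b := rfl
@[simp] lemma one_a : (1 : Heis r).a = 0 := rfl
@[simp] lemma one_b : (1 : Heis r).b = 0 := rfl
@[simp] lemma one_c : (1 : Heis r).c = 0 := rfl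
@[simp] lemma inv_a (x : Heis r) : x⁻¹.a = -x.a := rfl
@[simp] lemma inv_b (x : Heis r) : x⁻¹.b = -x.b := rfl
@[simp] lemma inv_c (x : Heis r) : x⁻¹.c = -x.c + r * x.a * x.b := rfl

instance instGroup : Group (Heis r) where
  mul_assoc x y z := by ext <;> simp <;> ring
  one_mul x := by ext <;> simp
  mul_one x := by ext <;> simp
  inv_mul_cancel x := by ext <;> simp <;> ring

/-- The generator δ₁ of H(r). -/
def δ₁ : Heis r := ⟨1, 0, 0⟩

/-- The generator δ₂ of H(r). -/
def δ₂ : Heis r := ⟨0, 1, 0⟩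

/-- The generator δ₃ of H(r); it generates the center of H(r) (for r > 0). -/
def δ₃ : Heis r := ⟨0, 0, 1⟩

end Heis

namespace Heis

variable {r : ℕ}

def aHom : Heis r →* Multiplicative ℤ where
  toFun x := Multiplicative.ofAdd x.a
  map_one' := rfl
  map_mul' _ _ := rfl

def bHom : Heis r →* Multiplicative ℤ where
  toFun x := Multiplicative.ofAdd x.b
  map_one' := rfl
  map_mul' _ _ := rfl

lemma zpow_a (x : Heis r) (n : ℤ) : (x ^ n).a = n * x.a := by
  have := congrArg Multiplicative.toAdd (map_zpow (aHom (r := r)) x n)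
  simpa [aHom] using this

lemma zpow_b (x : Heis r) (n : ℤ) : (x ^ n).b = n * x.b := by
  have := congrArg Multiplicative.toAdd (map_zpow (bHom (r := r)) x n)
  simpa [bHom] using this

def zHom : Multiplicative ℤ →* Heis r where
  toFun c := ⟨0, 0, c.toAdd⟩
  map_one' := rfl
  map_mul' x y := by ext <;> simp

lemma z_zpow (c n : ℤ) : (⟨0, 0, c⟩ : Heis r) ^ n = ⟨0, 0, n * c⟩ := by
  have := map_zpow (zHom (r := r)) (Multiplicative.ofAdd c) n
  simpa [zHom] using this.symm

lemma comm_rel (x y : Heis r) :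
    x * y = y * x * ⟨0, 0, r * (x.a * y.b - x.b * y.a)⟩ := by
  ext <;> simp <;> ring

lemma comm_mem {Γ : Subgroup (Heis r)} {x y : Heis r} (hx : x ∈ Γ) (hy : y ∈ Γ) :
    (⟨0, 0, r * (x.a * y.b - x.b * y.a)⟩ : Heis r) ∈ Γ := by
  have h : (⟨0, 0, r * (x.a * y.b - x.b * y.a)⟩ : Heis r) = (y * x)⁻¹ * (x * y) := by
    rw [comm_rel x y]; group
  rw [h]
  exact Γ.mul_mem (Γ.inv_mem (Γ.mul_mem hy hx)) (Γ.mul_mem hx hy)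

lemma z_mem {Γ : Subgroup (Heis r)} {c n : ℤ} (h : (⟨0, 0, c⟩ : Heis r) ∈ Γ) (hd : c ∣ n) :
    (⟨0, 0, n⟩ : Heis r) ∈ Γ := by
  obtain ⟨k, rfl⟩ := hd
  have := Γ.zpow_mem h k
  rwa [z_zpow, mul_comm] at this

lemma exists_gen (S : AddSubgroup ℤ) (n : ℤ) (hn : n ≠ 0) (h : n ∈ S) :
    ∃ d : ℤ, 0 < d ∧ d ∈ S ∧ ∀ x ∈ S, d ∣ x := by
  obtain ⟨a, rfl⟩ := Int.subgroup_cyclic S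
  simp only [← AddSubgroup.zmultiples_eq_closure, Int.mem_zmultiples_iff] at *
  have ha : a ≠ 0 := by rintro rfl; exact hn (zero_dvd_iff.mp h)
  exact ⟨|a|, abs_pos.mpr ha, (dvd_abs _ _).mpr dvd_rfl, fun x hx => (abs_dvd _ _).mpr hx⟩

lemma fin_index_of_box (hr : 0 < r) (Γ : Subgroup (Heis r)) {x y : Heis r} (hx : x ∈ Γ)
    (hy : y ∈ Γ) (hD : x.a * y.b - x.b * y.a ≠ 0) : Γ.FiniteIndex := by
  set D := x.a * y.b - x.b * y.a with hDdef
  have hM : (r : ℤ) * D ≠ 0 := mul_ne_zero (by exact_mod_cast hr.ne') hD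
  have hz : (⟨0, 0, r * D⟩ : Heis r) ∈ Γ := comm_mem hx hy
  let f : (Set.Ico (0 : ℤ) |D|) × (Set.Ico (0 : ℤ) |D|) × (Set.Ico (0 : ℤ) |r * D|) →
      Heis r ⧸ Γ := fun p => ((⟨p.1, p.2.1, p.2.2⟩ : Heis r) : Heis r ⧸ Γ)
  have hf : Function.Surjective f := by
    intro q
    induction q using QuotientGroup.induction_on with
    | H g =>
      -- kill the quotients of the first two coordinates
      let p := g.a / D
      let q := g.b / D
      let i := -(p * y.b - q * y.a)
      let j := -(q * x.a - p * x.b)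
      let γ := x ^ i * y ^ j
      have hγ : γ ∈ Γ := Γ.mul_mem (Γ.zpow_mem hx _) (Γ.zpow_mem hy _)
      have h1 : (g * γ).a = g.a % D := by
        have := Int.emod_add_mul_ediv g.a D
        simp only [γ, mul_a, zpow_a, i, j, p, q]
        rw [hDdef] at *
        linear_combination -this
      have h2 : (g * γ).b = g.b % D := by
        have := Int.emod_add_mul_ediv g.b D
        simp only [γ, mul_b, zpow_b, i, j, p, q]
        rw [hDdef] at *
        linear_combination -this
      let w : Heis r := ⟨0, 0, (r * D) * -((g * γ).c / (r * D))⟩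
      have hw : w ∈ Γ := z_mem hz (Dvd.intro _ rfl)
      have h3 : (g * γ * w).c = (g * γ).c % (r * D) := by
        have := Int.emod_add_mul_ediv (g * γ).c (r * D)
        rw [mul_c (g * γ) w]
        simp only [w]
        linear_combination -this
      refine ⟨⟨⟨g.a % D, Int.emod_nonneg _ hD, Int.emod_lt_abs _ hD⟩,
        ⟨g.b % D, Int.emod_nonneg _ hD, Int.emod_lt_abs _ hD⟩,
        ⟨(g * γ).c % (r * D), Int.emod_nonneg _ hM, Int.emod_lt_abs _ hM⟩⟩, ?_⟩
      have he : (⟨g.a % D, g.b % D, (g * γ).c % (r * D)⟩ : Heis r) = g * (γ * w) := by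
        rw [← mul_assoc g γ w]
        ext
        · rw [mul_a (g * γ) w, h1]; simp [w]
        · rw [mul_b (g * γ) w, h2]; simp [w]
        · exact h3.symm
      change ((⟨g.a % D, g.b % D, (g * γ).c % (r * D)⟩ : Heis r) : Heis r ⧸ Γ) = _
      rw [he]
      exact QuotientGroup.mk_mul_of_mem g (Γ.mul_mem hγ hw)
  have : Finite (Heis r ⧸ Γ) := Finite.of_surjective f hf
  exact Subgroup.finiteIndex_of_finite_quotient

def aSub (Γ : Subgroup (Heis r)) : AddSubgroup ℤ where
  carrier := {n | ∃ x ∈ Γ, x.a = n}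
  zero_mem' := ⟨1, Γ.one_mem, rfl⟩
  add_mem' := by
    rintro _ _ ⟨x, hx, rfl⟩ ⟨y, hy, rfl⟩
    exact ⟨x * y, Γ.mul_mem hx hy, rfl⟩
  neg_mem' := by
    rintro _ ⟨x, hx, rfl⟩
    exact ⟨x⁻¹, Γ.inv_mem hx, rfl⟩

def bSub (Γ : Subgroup (Heis r)) : AddSubgroup ℤ where
  carrier := {n | ∃ x ∈ Γ, x.a = 0 ∧ x.b = n}
  zero_mem' := ⟨1, Γ.one_mem, rfl, rfl⟩
  add_mem' := by
    rintro _ _ ⟨x, hx, h, rfl⟩ ⟨y, hy, h', rfl⟩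
    exact ⟨x * y, Γ.mul_mem hx hy, by simp [h, h'], rfl⟩
  neg_mem' := by
    rintro _ ⟨x, hx, h, rfl⟩
    exact ⟨x⁻¹, Γ.inv_mem hx, by simp [h], rfl⟩

def cSub (Γ : Subgroup (Heis r)) : AddSubgroup ℤ where
  carrier := {n | (⟨0, 0, n⟩ : Heis r) ∈ Γ}
  zero_mem' := Γ.one_mem
  add_mem' := by
    intro m n hm hn
    have h := Γ.mul_mem hm hn
    have e : (⟨0, 0, m + n⟩ : Heis r) = ⟨0, 0, m⟩ * ⟨0, 0, n⟩ := by ext <;> simp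
    change (⟨0, 0, m + n⟩ : Heis r) ∈ Γ
    rwa [e]
  neg_mem' := by
    intro m hm
    exact z_mem hm (by simp)

lemma iso_of_finite (hr : 0 < r) (Γ : Subgroup (Heis r)) (hΓ : Γ.FiniteIndex) :
    ∃ r' : ℕ, 0 < r' ∧ Nonempty (Γ ≃* Heis r') := by
  have hp := fun g : Heis r => Subgroup.exists_pow_mem_of_index_ne_zero hΓ.index_ne_zero g
  obtain ⟨n₁, hn₁, -, h₁⟩ := hp ⟨1, 0, 0⟩
  obtain ⟨n₂, hn₂, -, h₂⟩ := hp ⟨0, 1, 0⟩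
  obtain ⟨n₃, hn₃, -, h₃⟩ := hp ⟨0, 0, 1⟩
  rw [← zpow_natCast] at h₁ h₂ h₃
  obtain ⟨d, hd, ⟨u, hu, hua⟩, hdm⟩ := exists_gen (aSub Γ) n₁ (by exact_mod_cast hn₁.ne')
    ⟨_, h₁, by rw [zpow_a]; simp⟩
  obtain ⟨e, he, ⟨v, hv, hva, hvb⟩, hem⟩ := exists_gen (bSub Γ) n₂ (by exact_mod_cast hn₂.ne')
    ⟨_, h₂, by rw [zpow_a]; simp, by rw [zpow_b]; simp⟩
  obtain ⟨f, hf, hfz, hfm⟩ := exists_gen (cSub Γ) n₃ (by exact_mod_cast hn₃.ne')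
    (by rw [z_zpow, mul_one] at h₃; exact h₃)
  obtain ⟨s, hs⟩ : f ∣ r * (d * e) := by
    have := hfm _ (comm_mem hu hv)
    simpa [hua, hva, hvb] using this
  have hs0 : 0 < s := by
    have h : 0 < f * s := by rw [← hs]; positivity
    exact pos_of_mul_pos_right h hf.le
  lift s to ℕ using hs0.le
  refine ⟨s, by exact_mod_cast hs0, ⟨MulEquiv.symm ?_⟩⟩
  let φ : Heis s → Heis r := fun x => v ^ x.b * u ^ x.a * ⟨0, 0, x.c * f⟩
  have hφΓ : ∀ x, φ x ∈ Γ := fun x =>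
    Γ.mul_mem (Γ.mul_mem (Γ.zpow_mem hv _) (Γ.zpow_mem hu _)) (z_mem hfz (Dvd.intro_left _ rfl))
  have hmul : ∀ x y, φ (x * y) = φ x * φ y := by
    intro x y
    have key := comm_rel (u ^ x.a) (v ^ y.b)
    simp only [zpow_a, zpow_b, hua, hva, hvb, mul_zero, sub_zero] at key
    have hz : ∀ (g : Heis r) (c : ℤ), (⟨0, 0, c⟩ : Heis r) * g = g * ⟨0, 0, c⟩ := by
      intro g c; ext <;> simp; ring
    have hzz : ∀ (c c' : ℤ), (⟨0, 0, c⟩ : Heis r) * ⟨0, 0, c'⟩ = ⟨0, 0, c + c'⟩ := by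
      intro c c'; ext <;> simp
    simp only [φ, mul_a, mul_b, mul_c, zpow_add]
    have e1 : (x.c + y.c + (s : ℤ) * x.a * y.b) * f
        = r * (x.a * d * (y.b * e)) + x.c * f + y.c * f := by
      linear_combination (-x.a * y.b) * hs
    rw [e1, ← hzz, ← hzz]
    calc _ = v ^ x.b * (v ^ y.b * u ^ x.a * (u ^ y.a * ⟨0, 0, r * (x.a * d * (y.b * e))⟩))
            * ⟨0, 0, x.c * f⟩ * ⟨0, 0, y.c * f⟩ := by simp only [mul_assoc]
      _ = v ^ x.b * ((v ^ y.b * u ^ x.a * ⟨0, 0, r * (x.a * d * (y.b * e))⟩) * u ^ y.a)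
            * ⟨0, 0, x.c * f⟩ * ⟨0, 0, y.c * f⟩ := by rw [← hz (u ^ y.a)]; simp only [mul_assoc]
      _ = v ^ x.b * u ^ x.a * ((v ^ y.b * u ^ y.a) * ⟨0, 0, x.c * f⟩) * ⟨0, 0, y.c * f⟩ := by
          rw [← key]; simp only [mul_assoc]
      _ = _ := by rw [← hz (v ^ y.b * u ^ y.a)]; simp only [mul_assoc]
  let F : Heis s →* Γ := MonoidHom.mk' (fun x => ⟨φ x, hφΓ x⟩) (fun x y => Subtype.ext (hmul x y))
  refine MulEquiv.ofBijective F ⟨?_, ?_⟩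
  · rw [injective_iff_map_eq_one]
    intro x hx
    have hx : φ x = 1 := congrArg Subtype.val hx
    have ha := congrArg Heis.a hx
    have hb := congrArg Heis.b hx
    have ha : x.a = 0 := by
      simpa [φ, zpow_a, hua, hva, hd.ne'] using ha
    have hb : x.b = 0 := by
      simpa [φ, zpow_b, ha, hvb, he.ne'] using hb
    have hc := congrArg Heis.c hx
    have hc : x.c = 0 := by
      simpa [φ, ha, hb, hf.ne'] using hc
    ext <;> simp [ha, hb, hc]
  · rintro ⟨g, hg⟩
    obtain ⟨i, hi⟩ := hdm _ ⟨g, hg, rfl⟩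
    have hg1 : g * (u ^ i)⁻¹ ∈ Γ := Γ.mul_mem hg (Γ.inv_mem (Γ.zpow_mem hu _))
    have hg1a : (g * (u ^ i)⁻¹).a = 0 := by simp [zpow_a, hua, hi]; ring
    obtain ⟨j, hj⟩ := hem _ ⟨_, hg1, hg1a, rfl⟩
    let t := (v ^ j * u ^ i)⁻¹ * g
    have ht : t ∈ Γ := Γ.mul_mem (Γ.inv_mem (Γ.mul_mem (Γ.zpow_mem hv _) (Γ.zpow_mem hu _))) hg
    have hta : t.a = 0 := by simp [t, zpow_a, hua, hva, hi]; ring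
    have htb : t.b = 0 := by
      simp [zpow_b] at hj
      simp [t, zpow_b, hvb]
      linear_combination hj
    have hte : t = ⟨0, 0, t.c⟩ := by ext <;> simp [hta, htb]
    obtain ⟨k, hk⟩ := hfm t.c (by change (⟨0, 0, t.c⟩ : Heis r) ∈ Γ; rwa [← hte])
    refine ⟨⟨i, j, k⟩, Subtype.ext ?_⟩
    change v ^ j * u ^ i * ⟨0, 0, k * f⟩ = g
    rw [mul_comm k f, ← hk, ← hte]
    exact mul_inv_cancel_left _ _

end Heis

/-- Lemma A.6: every finite-index subgroup of H(r) is isomorphic to H(r') for some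
positive integer r', and every infinite-index subgroup of H(r) is abelian. -/
theorem stmt_12 (r : ℕ) (hr : 0 < r) (Γ : Subgroup (Heis r)) :
    (Γ.FiniteIndex → ∃ r' : ℕ, 0 < r' ∧ Nonempty (Γ ≃* Heis r')) ∧
    (¬ Γ.FiniteIndex → ∀ x y : Γ, x * y = y * x) := by
  refine ⟨Heis.iso_of_finite hr Γ, fun hn x y => ?_⟩
  by_contra hxy
  apply hn
  apply Heis.fin_index_of_box hr Γ x.2 y.2
  intro hD
  apply hxy
  apply Subtype.ext
  have h := Heis.comm_rel (x : Heis r) y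
  rw [hD, mul_zero] at h
  exact h.trans (mul_one _)
end

section
/- Let r be a positive integer and let Γ = Γ₀ ⋊ Γ₁ be a semidirect product with Γ₀ ≅ H(r) and Γ₁ ≅ ℤ; let M ∈ GL₂(ℤ) be the matrix describing the induced action of the generator of Γ₁ on Γ₀/z(Γ₀) ≅ ℤ². Suppose the eigenvalues of M are not roots of unity. Then there exists a constant ν = ν(Γ) with the following property: whenever Γ̂ = Γ̂₀ ⋊ Γ̂₁ is a semidirect product with Γ̂₀ ≅ H(r̂) for some positive integer r̂ and Γ̂₁ ≅ ℤ, and Γ ⊆ Γ̂ is a normal subgroup, the quotient group G = Γ̂/Γ is finite and has a normal abelian subgroup of index at most ν. -/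
open Matrix

/-- The semidirect product H(r) ⋊ ℤ in which a fixed generator γ of ℤ (the image of
`Multiplicative.ofAdd 1`) acts on H(r) by the automorphism ψ. -/
abbrev HeisSdp (r : ℕ) (ψ : MulAut (Heis r)) : Type :=
  SemidirectProduct (Heis r) (Multiplicative ℤ) (zpowersHom _ ψ)

/-- `InducedMatrix r ψ M` says that the automorphism of H(r)/z(H(r)) ≅ ℤ² induced by
the automorphism ψ of H(r) is given by the matrix M ∈ GL₂(ℤ) in the basis consisting
of the images of δ₁ and δ₂, i.e. ψ(δᵢ) = δ₁^{M₁ᵢ} δ₂^{M₂ᵢ} δ₃^{pᵢ} for i = 1,2. -/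
def InducedMatrix (r : ℕ) (ψ : MulAut (Heis r)) (M : GL (Fin 2) ℤ) : Prop :=
  (ψ Heis.δ₁).a = (M : Matrix (Fin 2) (Fin 2) ℤ) 0 0 ∧
  (ψ Heis.δ₁).b = (M : Matrix (Fin 2) (Fin 2) ℤ) 1 0 ∧
  (ψ Heis.δ₂).a = (M : Matrix (Fin 2) (Fin 2) ℤ) 0 1 ∧
  (ψ Heis.δ₂).b = (M : Matrix (Fin 2) (Fin 2) ℤ) 1 1

namespace Heis

variable {r : ℕ}

def hA : Multiplicative ℤ →* Heis r :=
  MonoidHom.mk' (fun n => ⟨n.toAdd, 0, 0⟩) (by intro a b; ext <;> simp)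
def hB : Multiplicative ℤ →* Heis r :=
  MonoidHom.mk' (fun n => ⟨0, n.toAdd, 0⟩) (by intro a b; ext <;> simp)
def hC : Multiplicative ℤ →* Heis r :=
  MonoidHom.mk' (fun n => ⟨0, 0, n.toAdd⟩) (by intro a b; ext <;> simp)

lemma d1_zpow (n : ℤ) : (δ₁ : Heis r) ^ n = ⟨n, 0, 0⟩ := by
  have := map_zpow (hA (r := r)) (Multiplicative.ofAdd 1) n
  simpa [hA, δ₁] using this.symm
lemma d2_zpow (n : ℤ) : (δ₂ : Heis r) ^ n = ⟨0, n, 0⟩ := by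
  have := map_zpow (hB (r := r)) (Multiplicative.ofAdd 1) n
  simpa [hB, δ₂] using this.symm
lemma d3_zpow (n : ℤ) : (δ₃ : Heis r) ^ n = ⟨0, 0, n⟩ := by
  have := map_zpow (hC (r := r)) (Multiplicative.ofAdd 1) n
  simpa [hC, δ₃] using this.symm

lemma decomp (x : Heis r) :
    x = δ₁ ^ x.a * δ₂ ^ x.b * δ₃ ^ (x.c - r * x.a * x.b) := by
  rw [d1_zpow, d2_zpow, d3_zpow]; ext <;> simp

def pa : Heis r →* Multiplicative ℤ :=
  MonoidHom.mk' (fun x => Multiplicative.ofAdd x.a) (by intro a b; simp)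
def pb : Heis r →* Multiplicative ℤ :=
  MonoidHom.mk' (fun x => Multiplicative.ofAdd x.b) (by intro a b; simp)

lemma pow_a (x : Heis r) (n : ℕ) : (x ^ n).a = n * x.a := by
  have := congrArg Multiplicative.toAdd (map_pow (pa (r := r)) x n)
  simpa [pa] using this
lemma pow_b (x : Heis r) (n : ℕ) : (x ^ n).b = n * x.b := by
  have := congrArg Multiplicative.toAdd (map_pow (pb (r := r)) x n)
  simpa [pb] using this

lemma d_rel : (δ₁ : Heis r) * δ₂ = δ₂ * δ₁ * δ₃ ^ (r : ℤ) := by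
  rw [d3_zpow]; ext <;> simp [δ₁, δ₂]

lemma hom_d3 (hr : 0 < r) (f : Heis r →* Multiplicative ℤ) : f δ₃ = 1 := by
  have h := congrArg (fun x => (f x).toAdd) (d_rel (r := r))
  simp only [map_mul, map_zpow, toAdd_mul, toAdd_zpow, smul_eq_mul] at h
  have h2 : (r : ℤ) * (f δ₃).toAdd = 0 := by linarith
  have h3 : (f δ₃).toAdd = 0 := by
    rcases mul_eq_zero.1 h2 with h | h
    · omega
    · exact h
  exact Multiplicative.toAdd.injective h3

lemma hom_eq (hr : 0 < r) (f : Heis r →* Multiplicative ℤ) (x : Heis r) :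
    (f x).toAdd = x.a * (f δ₁).toAdd + x.b * (f δ₂).toAdd := by
  conv_lhs => rw [decomp x]
  simp only [map_mul, map_zpow, toAdd_mul, toAdd_zpow, smul_eq_mul, hom_d3 hr f, toAdd_one]
  ring

lemma comm_iff (hr : 0 < r) (x y : Heis r) : x * y = y * x ↔ x.a * y.b = y.a * x.b := by
  have hr' : (r : ℤ) ≠ 0 := by omega
  constructor
  · intro h
    have h := congrArg Heis.c h
    simp only [mul_c] at h
    apply mul_left_cancel₀ hr'
    linarith
  · intro h
    ext
    · simp; ring
    · simp; ring
    · simp only [mul_c]; linear_combination (r : ℤ) * h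

lemma central (hr : 0 < r) (x : Heis r) (h : ∀ y, x * y = y * x) : x.a = 0 ∧ x.b = 0 := by
  have h1 := (comm_iff hr _ _).1 (h δ₁)
  have h2 := (comm_iff hr _ _).1 (h δ₂)
  simp [δ₁, δ₂] at h1 h2
  exact ⟨h2, h1.symm⟩

end Heis

open Heis

lemma ind_a {r : ℕ} (hr : 0 < r) {ψ : MulAut (Heis r)} {M : GL (Fin 2) ℤ}
    (hM : InducedMatrix r ψ M) (x : Heis r) :
    ![(ψ x).a, (ψ x).b] = (M : Matrix (Fin 2) (Fin 2) ℤ) *ᵥ ![x.a, x.b] := by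
  obtain ⟨h1, h2, h3, h4⟩ := hM
  have ha := hom_eq hr (pa.comp ψ.toMonoidHom) x
  have hb := hom_eq hr (pb.comp ψ.toMonoidHom) x
  simp [pa, pb, h1, h2, h3, h4] at ha hb
  ext i
  fin_cases i
  · simp [Matrix.mulVec, dotProduct, Fin.sum_univ_two, ha]; ring
  · simp [Matrix.mulVec, dotProduct, Fin.sum_univ_two, hb]; ring

lemma ind_pow {r : ℕ} (hr : 0 < r) {ψ : MulAut (Heis r)} {M : GL (Fin 2) ℤ}
    (hM : InducedMatrix r ψ M) (n : ℕ) (x : Heis r) :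
    ![((ψ ^ n) x).a, ((ψ ^ n) x).b] = ((M : Matrix (Fin 2) (Fin 2) ℤ) ^ n) *ᵥ ![x.a, x.b] := by
  induction n with
  | zero => simp
  | succ n ih =>
    rw [pow_succ', pow_succ', MulAut.mul_apply, ind_a hr hM, ih, Matrix.mulVec_mulVec]

def NoRoot (M : GL (Fin 2) ℤ) : Prop := ∀ μ : ℂ,
      (((M : Matrix (Fin 2) (Fin 2) ℤ).map ((↑) : ℤ → ℂ)).charpoly).IsRoot μ →
        ¬ ∃ k : ℕ, 0 < k ∧ μ ^ k = 1

lemma pow_ne {M : GL (Fin 2) ℤ} (hE : NoRoot M) (n : ℕ) (hn : 0 < n) :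
    (M : Matrix (Fin 2) (Fin 2) ℤ) ^ n ≠ 1 := by
  intro h
  set N : Matrix (Fin 2) (Fin 2) ℂ := (M : Matrix (Fin 2) (Fin 2) ℤ).map ((↑) : ℤ → ℂ) with hN
  have hNn : N ^ n = 1 := by
    have := congrArg (fun A => (Int.castRingHom ℂ).mapMatrix A) h
    simpa [map_pow, hN] using this
  obtain ⟨μ, hμ⟩ := Complex.exists_root (f := N.charpoly)
    (by rw [Matrix.charpoly_degree_eq_dim]; simp)
  refine hE μ hμ ⟨n, hn, ?_⟩
  have hd : (Matrix.scalar (Fin 2) μ - N).det = 0 := by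
    rw [← Matrix.eval_charpoly]; exact hμ
  obtain ⟨v, hv, hv2⟩ := Matrix.exists_mulVec_eq_zero_iff.2 hd
  have hv3 : N *ᵥ v = μ • v := by
    rw [Matrix.sub_mulVec, sub_eq_zero] at hv2
    rw [← hv2]; simp
  have hv4 : ∀ k : ℕ, (N ^ k) *ᵥ v = μ ^ k • v := by
    intro k
    induction k with
    | zero => simp
    | succ k ih => rw [pow_succ, ← Matrix.mulVec_mulVec, hv3, Matrix.mulVec_smul, ih, smul_smul, pow_succ']
  have h5 := hv4 n
  rw [hNn, Matrix.one_mulVec] at h5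
  have h6 : (μ ^ n - 1) • v = 0 := by rw [sub_smul, ← h5]; simp
  rcases smul_eq_zero.1 h6 with h | h
  · exact sub_eq_zero.1 h
  · exact absurd h hv

lemma det_ne {M : GL (Fin 2) ℤ} (hE : NoRoot M) :
    ((M : Matrix (Fin 2) (Fin 2) ℤ) 0 0 - 1) * ((M : Matrix (Fin 2) (Fin 2) ℤ) 1 1 - 1)
      - (M : Matrix (Fin 2) (Fin 2) ℤ) 0 1 * (M : Matrix (Fin 2) (Fin 2) ℤ) 1 0 ≠ 0 := by
  intro h
  refine hE 1 ?_ ⟨1, one_pos, by simp⟩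
  rw [Polynomial.IsRoot, Matrix.eval_charpoly, Matrix.det_fin_two]
  have := congrArg (Int.cast : ℤ → ℂ) h
  push_cast at this
  simp
  linear_combination this

lemma act_nontriv {r : ℕ} (hr : 0 < r) {ψ : MulAut (Heis r)} {M : GL (Fin 2) ℤ}
    (hM : InducedMatrix r ψ M) (hE : NoRoot M) (n : ℕ) (hn : 0 < n)
    (h : ∀ x : Heis r, ((ψ ^ n) x).a = x.a ∧ ((ψ ^ n) x).b = x.b) : False := by
  apply pow_ne hE n hn
  have h1 : ∀ x : Heis r, ((M : Matrix (Fin 2) (Fin 2) ℤ) ^ n) *ᵥ ![x.a, x.b] = ![x.a, x.b] := by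
    intro x
    rw [← ind_pow hr hM, (h x).1, (h x).2]
  have e1 := h1 δ₁
  have e2 := h1 δ₂
  have f1 := congrFun e1 0
  have f2 := congrFun e1 1
  have f3 := congrFun e2 0
  have f4 := congrFun e2 1
  simp [δ₁, δ₂, Matrix.mulVec, dotProduct, Fin.sum_univ_two] at f1 f2 f3 f4
  ext i j
  fin_cases i <;> fin_cases j <;> simp [f1, f2, f3, f4]

/-- An element centralizing the Heisenberg part is central in it. -/
lemma cent_nat {r : ℕ} (hr : 0 < r) {ψ : MulAut (Heis r)} {M : GL (Fin 2) ℤ}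
    (hM : InducedMatrix r ψ M) (hE : NoRoot M) (n : ℕ) (g : HeisSdp r ψ)
    (hg : g.right = Multiplicative.ofAdd (n : ℤ))
    (h : ∀ x : Heis r, g * SemidirectProduct.inl x = SemidirectProduct.inl x * g) :
    n = 0 := by
  by_contra hn
  apply act_nontriv hr hM hE n (Nat.pos_of_ne_zero hn)
  intro x
  have h1 := congrArg SemidirectProduct.left (h x)
  simp [hg] at h1
  have ha := congrArg Heis.a h1
  have hb := congrArg Heis.b h1
  simp at ha hb
  constructor <;> linarith

lemma cent {r : ℕ} (hr : 0 < r) {ψ : MulAut (Heis r)} {M : GL (Fin 2) ℤ}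
    (hM : InducedMatrix r ψ M) (hE : NoRoot M) (g : HeisSdp r ψ)
    (h : ∀ x : Heis r, g * SemidirectProduct.inl x = SemidirectProduct.inl x * g) :
    ∃ c : ℤ, g = SemidirectProduct.inl (δ₃ ^ c) := by
  have h0 : g.right = 1 := by
    rcases Int.eq_nat_or_neg g.right.toAdd with ⟨n, hn | hn⟩
    · have := cent_nat hr hM hE n g (by rw [← hn]; simp) h
      subst this
      exact Multiplicative.toAdd.injective (by simpa using hn)
    · have := cent_nat hr hM hE n g⁻¹
        (by rw [SemidirectProduct.inv_right]; apply Multiplicative.toAdd.injective; simp [hn])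
        (fun x => by
          have := h x
          have c : Commute g (SemidirectProduct.inl x) := this
          exact c.inv_left)
      subst this
      exact Multiplicative.toAdd.injective (by simpa using hn)
  have hg : g = SemidirectProduct.inl g.left := by
    ext1 <;> simp [h0]
  have hc := central hr g.left (fun y => by
    have := h y
    rw [hg, ← map_mul, ← map_mul] at this
    exact SemidirectProduct.inl_injective this)
  refine ⟨g.left.c, ?_⟩
  rw [hg, d3_zpow]
  congr 1
  ext <;> simp [hc.1, hc.2]

lemma hom_triv {r : ℕ} (hr : 0 < r) {ψ : MulAut (Heis r)} {M : GL (Fin 2) ℤ}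
    (hM : InducedMatrix r ψ M) (hE : NoRoot M) (f : HeisSdp r ψ →* Multiplicative ℤ)
    (x : Heis r) : f (SemidirectProduct.inl x) = 1 := by
  set F : Heis r →* Multiplicative ℤ := f.comp SemidirectProduct.inl with hF
  have hinv : ∀ y, F (ψ y) = F y := by
    intro y
    have h : (SemidirectProduct.inr (Multiplicative.ofAdd 1) : HeisSdp r ψ) * SemidirectProduct.inl y
        = SemidirectProduct.inl (ψ y) * SemidirectProduct.inr (Multiplicative.ofAdd 1) := by
      ext1 <;> simp
    have h2 := congrArg f h
    rw [map_mul, map_mul, mul_comm] at h2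
    exact (mul_right_cancel h2).symm
  obtain ⟨m1, m2, m3, m4⟩ := hM
  have e1 := hom_eq hr F (ψ δ₁)
  have e2 := hom_eq hr F (ψ δ₂)
  rw [hinv, m1, m2] at e1
  rw [hinv, m3, m4] at e2
  have hd := det_ne hE
  have p0 : (F δ₁).toAdd = 0 := by
    apply (mul_eq_zero.1 (?_ : _ * (F δ₁).toAdd = 0)).resolve_left hd
    linear_combination (-((M : Matrix (Fin 2) (Fin 2) ℤ) 1 1 - 1)) * e1 + (M : Matrix (Fin 2) (Fin 2) ℤ) 1 0 * e2
  have q0 : (F δ₂).toAdd = 0 := by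
    apply (mul_eq_zero.1 (?_ : _ * (F δ₂).toAdd = 0)).resolve_left hd
    linear_combination ((M : Matrix (Fin 2) (Fin 2) ℤ) 0 1) * e1 - ((M : Matrix (Fin 2) (Fin 2) ℤ) 0 0 - 1) * e2
  have := hom_eq hr F x
  rw [p0, q0, mul_zero, mul_zero, add_zero] at this
  exact Multiplicative.toAdd.injective this

/-- The key structural facts. -/
lemma key {r : ℕ} (hr : 0 < r) {ψ : MulAut (Heis r)} {M : GL (Fin 2) ℤ}
    (hM : InducedMatrix r ψ M) (hE : NoRoot M) {s : ℕ} (hs : 0 < s) (χ : MulAut (Heis s))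
    (K : Subgroup (HeisSdp s χ)) [K.Normal] (e : HeisSdp r ψ ≃* K) :
    (∃ g ∈ K, g.right ≠ 1) ∧
    (∃ d : ℤ, d ≠ 0 ∧ SemidirectProduct.inl (δ₃ ^ d) ∈ K) ∧
    (∀ x : Heis s, ∃ c : ℤ, SemidirectProduct.inl (x ^ r * δ₃ ^ c) ∈ K) := by
  set φ : HeisSdp r ψ →* HeisSdp s χ := K.subtype.comp e.toMonoidHom with hφ
  have hinj : Function.Injective φ := K.subtype_injective.comp e.injective
  have hmem : ∀ g, φ g ∈ K := fun g => (e g).2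
  have hsurj : ∀ k ∈ K, ∃ g, φ g = k := fun k hk => ⟨e.symm ⟨k, hk⟩, by simp [hφ]⟩
  have hright : ∀ x, (φ (SemidirectProduct.inl x)).right = 1 := fun x =>
    hom_triv hr hM hE (SemidirectProduct.rightHom.comp φ) x
  have hP0 : ∀ x, ∃ y, φ (SemidirectProduct.inl x) = SemidirectProduct.inl y := fun x =>
    ⟨(φ (SemidirectProduct.inl x)).left, by ext1 <;> simp [hright]⟩
  choose P0 hP0 using hP0
  obtain ⟨P, hP⟩ : ∃ P : Heis r →* Heis s, ∀ x, φ (SemidirectProduct.inl x) = SemidirectProduct.inl (P x) :=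
    ⟨MonoidHom.mk' P0 (fun x y => by
      apply SemidirectProduct.inl_injective (φ := zpowersHom _ χ)
      rw [← hP0, map_mul, map_mul, map_mul, hP0, hP0]), hP0⟩
  have hPinj : Function.Injective P := by
    intro x y h
    apply SemidirectProduct.inl_injective (φ := zpowersHom _ ψ)
    apply hinj
    rw [hP, hP, h]
  -- image of the center
  have hWa : (P δ₃).a = 0 := congrArg Multiplicative.toAdd (hom_d3 hr (pa.comp P))
  have hWb : (P δ₃).b = 0 := congrArg Multiplicative.toAdd (hom_d3 hr (pb.comp P))
  set d : ℤ := (P δ₃).c with hd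
  have hW : P δ₃ = δ₃ ^ d := by
    rw [d3_zpow]; ext <;> simp [hWa, hWb, hd]
  have hd0 : d ≠ 0 := by
    intro h
    rw [h, zpow_zero, ← map_one P] at hW
    have := congrArg Heis.c (hPinj hW)
    simp [δ₃] at this
  have hPc : ∀ c : ℤ, P (δ₃ ^ c) = ⟨0, 0, d * c⟩ := by
    intro c
    rw [map_zpow, hW, ← _root_.zpow_mul, d3_zpow]
  -- central elements of K
  have hcen : ∀ z : Heis s, z.a = 0 → z.b = 0 → SemidirectProduct.inl z ∈ K → ∃ c, z.c = d * c := by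
    intro z h1 h2 hz
    obtain ⟨g, hg⟩ := hsurj _ hz
    obtain ⟨c, hc⟩ := cent hr hM hE g (fun x => by
      apply hinj
      rw [map_mul, map_mul, hg, hP, ← map_mul, ← map_mul]
      congr 1
      rw [comm_iff hs, h1, h2]; ring)
    refine ⟨c, ?_⟩
    rw [hc, hP, hPc] at hg
    rw [← SemidirectProduct.inl_injective hg]
  refine ⟨?_, ⟨d, hd0, by rw [← hW, ← hP]; exact hmem _⟩, ?_⟩
  · by_contra hcon
    push Not at hcon
    set T : HeisSdp s χ := φ (SemidirectProduct.inr (Multiplicative.ofAdd 1)) with hT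
    have hT1 : T = SemidirectProduct.inl T.left := by
      ext1 <;> simp [hcon T (hmem _)]
    apply act_nontriv hr hM hE 1 one_pos
    intro x
    rw [pow_one]
    have hrel : (SemidirectProduct.inr (Multiplicative.ofAdd 1) : HeisSdp r ψ) * SemidirectProduct.inl x
        = SemidirectProduct.inl (ψ x) * SemidirectProduct.inr (Multiplicative.ofAdd 1) := by
      ext1 <;> simp
    have h2 := congrArg φ hrel
    rw [map_mul, map_mul, ← hT, hP, hP, hT1, ← map_mul, ← map_mul] at h2
    have h3 := SemidirectProduct.inl_injective h2
    have ha := congrArg Heis.a h3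
    have hb := congrArg Heis.b h3
    simp only [mul_a, mul_b] at ha hb
    have hc := central hr (ψ x * x⁻¹) (fun y => by
      apply hPinj
      rw [map_mul P (ψ x * x⁻¹) y, map_mul P y, comm_iff hs]
      have k1 : (P (ψ x * x⁻¹)).a = 0 := by rw [map_mul, map_inv]; simp; linarith
      have k2 : (P (ψ x * x⁻¹)).b = 0 := by rw [map_mul, map_inv]; simp; linarith
      rw [k1, k2]; ring)
    simp at hc
    constructor <;> linarith [hc.1, hc.2]
  · intro x
    have hcomm : ∀ y : Heis r, ∃ c, (s : ℤ) * (x.a * (P y).b - (P y).a * x.b) = d * c := by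
      intro y
      have hm : SemidirectProduct.inl (x * P y * x⁻¹ * (P y)⁻¹) ∈ K := by
        rw [map_mul, map_mul, map_mul, map_inv, map_inv, ← hP]
        exact K.mul_mem (Subgroup.Normal.conj_mem inferInstance _ (hmem _) _) (K.inv_mem (hmem _))
      obtain ⟨c, hc⟩ := hcen _ (by simp) (by simp) hm
      refine ⟨c, ?_⟩
      rw [← hc]
      simp
      ring
    obtain ⟨α, hα⟩ := hcomm δ₁
    obtain ⟨β, hβ⟩ := hcomm δ₂
    have hrel : (s : ℤ) * ((P δ₁).a * (P δ₂).b - (P δ₂).a * (P δ₁).b) = r * d := by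
      have h := congrArg (fun y => (P y).c) (d_rel (r := r))
      simp only [map_mul, mul_c, hPc] at h
      linear_combination h
    set y := P (δ₁ ^ β * δ₂ ^ (-α)) with hy
    have hya : y.a = r * x.a := by
      have h1 := hom_eq hr (pa.comp P) (δ₁ ^ β * δ₂ ^ (-α))
      have h2 : y.a = β * (P δ₁).a + (-α) * (P δ₂).a := by
        rw [d1_zpow, d2_zpow] at h1
        rw [hy, d1_zpow, d2_zpow]
        have h3 := h1
        simp only [mul_a, mul_b, add_zero, zero_add] at h3
        exact h3
      rw [h2]
      apply mul_left_cancel₀ hd0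
      linear_combination x.a * hrel + (P δ₂).a * hα - (P δ₁).a * hβ
    have hyb : y.b = r * x.b := by
      have h1 := hom_eq hr (pb.comp P) (δ₁ ^ β * δ₂ ^ (-α))
      have h2 : y.b = β * (P δ₁).b + (-α) * (P δ₂).b := by
        rw [d1_zpow, d2_zpow] at h1
        rw [hy, d1_zpow, d2_zpow]
        have h3 := h1
        simp only [mul_a, mul_b, add_zero, zero_add] at h3
        exact h3
      rw [h2]
      apply mul_left_cancel₀ hd0
      linear_combination x.b * hrel + (P δ₂).b * hα - (P δ₁).b * hβ
    refine ⟨y.c - (x ^ r).c, ?_⟩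
    have : x ^ r * δ₃ ^ (y.c - (x ^ r).c) = y := by
      rw [d3_zpow]; ext <;> simp [pow_a, pow_b, hya, hyb]
    rw [this, hy, ← hP]
    exact hmem _


lemma core_index {G : Type*} [Group G] (H : Subgroup G) [H.FiniteIndex] :
    H.normalCore.index ≤ H.index.factorial := by
  apply Nat.le_of_dvd (Nat.factorial_pos _)
  rw [Subgroup.normalCore_eq_ker, Subgroup.index_ker, Subgroup.index_eq_card, ← Nat.card_perm]
  exact Subgroup.card_subgroup_dvd_card _

lemma grp {G : Type*} [Group G] (r : ℕ) (hr : 0 < r) (x y z t : G)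
    (hgen : ∀ g : G, ∃ a b c n : ℤ, g = x ^ a * y ^ b * z ^ c * t ^ n)
    (hx : ∃ c : ℤ, x ^ r = z ^ c) (hy : ∃ c : ℤ, y ^ r = z ^ c)
    (hz : IsOfFinOrder z) (ht : IsOfFinOrder t)
    (hzy : Commute z y) (htz : t * z = z * t ∨ t * z = z⁻¹ * t) :
    Finite G ∧ ∃ A : Subgroup G, A.Normal ∧ (∀ u v : A, u * v = v * u) ∧
      A.index ≤ (r * (r * 2)).factorial := by
  obtain ⟨c1, hc1⟩ := hx
  obtain ⟨c2, hc2⟩ := hy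
  have hxf : IsOfFinOrder x := (hc1 ▸ hz.zpow : IsOfFinOrder (x ^ r)).of_pow hr.ne'
  have hyf : IsOfFinOrder y := (hc2 ▸ hz.zpow : IsOfFinOrder (y ^ r)).of_pow hr.ne'
  have hfin : Finite G := by
    have i1 : Finite (Subgroup.zpowers x) := finite_zpowers.2 hxf
    have i2 : Finite (Subgroup.zpowers y) := finite_zpowers.2 hyf
    have i3 : Finite (Subgroup.zpowers z) := finite_zpowers.2 hz
    have i4 : Finite (Subgroup.zpowers t) := finite_zpowers.2 ht
    apply Finite.of_surjective (fun p : Subgroup.zpowers x × Subgroup.zpowers y ×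
      Subgroup.zpowers z × Subgroup.zpowers t => (p.1 * p.2.1 * p.2.2.1 * p.2.2.2 : G))
    intro g
    obtain ⟨a, b, c, n, h⟩ := hgen g
    exact ⟨(⟨x ^ a, a, rfl⟩, ⟨y ^ b, b, rfl⟩, ⟨z ^ c, c, rfl⟩, ⟨t ^ n, n, rfl⟩), h.symm⟩
  refine ⟨hfin, ?_⟩
  -- the element t moves powers of z
  have hmove : ∀ k : ℤ, ∃ l : ℤ, z ^ k * t = t * z ^ l := by
    intro k
    rcases htz with h | h
    · exact ⟨k, ((show Commute t z from h).zpow_right k).eq.symm⟩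
    · have h' : SemiconjBy t z z⁻¹ := h
      have := (h'.zpow_right (-k)).eq
      refine ⟨-k, ?_⟩
      rw [this]; simp
  have ht2 : Commute z (t ^ 2) := by
    rcases htz with h | h
    · exact ((show Commute t z from h).pow_left 2).symm
    · have h' : SemiconjBy t z z⁻¹ := h
      have h2 : SemiconjBy (t * t) z z := by simpa using h'.inv_right.mul_left h'
      rw [pow_two]
      exact h2.symm
  set B : Subgroup G := Subgroup.closure {z, t ^ 2} with hB
  have hzB : z ∈ B := Subgroup.subset_closure (by simp)
  have htB : t ^ 2 ∈ B := Subgroup.subset_closure (by simp)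
  have hBc : IsMulCommutative B := by
    apply Subgroup.isMulCommutative_closure
    rintro u (rfl | rfl) v (rfl | rfl)
    · rfl
    · exact ht2
    · exact ht2.symm
    · rfl
  have hBi : B.index ≤ r * (r * 2) := by
    have : Nat.card (Fin r × Fin r × Fin 2) = r * (r * 2) := by simp
    rw [← this, Subgroup.index_eq_card]
    apply Nat.card_le_card_of_surjective (fun p : Fin r × Fin r × Fin 2 =>
      (QuotientGroup.mk (x ^ (p.1 : ℕ) * y ^ (p.2.1 : ℕ) * t ^ (p.2.2 : ℕ)) : G ⧸ B))
    intro q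
    induction q using QuotientGroup.induction_on with
    | H g =>
    obtain ⟨a, b, c, n, h⟩ := hgen g
    have hr' : (0 : ℤ) < r := by exact_mod_cast hr
    have red : ∀ (w : G) (c' : ℤ) (_ : w ^ r = z ^ c') (a : ℤ),
        ∃ (i : Fin r) (k : ℤ), w ^ a = w ^ (i : ℕ) * z ^ k := by
      intro w c' hw a
      have h0 := Int.emod_nonneg a hr'.ne'
      have h1 := Int.emod_lt_of_pos a hr'
      refine ⟨⟨(a % r).toNat, by omega⟩, c' * (a / r), ?_⟩
      have e : a = ((a % r).toNat : ℤ) + r * (a / r) := by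
        rw [Int.toNat_of_nonneg h0]; exact (Int.emod_add_mul_ediv a r).symm
      conv_lhs => rw [e]
      rw [_root_.zpow_add, zpow_natCast, _root_.zpow_mul w, zpow_natCast, hw, ← _root_.zpow_mul]
    obtain ⟨i, k1, e1⟩ := red x c1 hc1 a
    obtain ⟨j, k2, e2⟩ := red y c2 hc2 b
    obtain ⟨ε, m, e3⟩ : ∃ (ε : Fin 2) (m : ℤ), t ^ n = t ^ (ε : ℕ) * (t ^ 2) ^ m := by
      refine ⟨⟨(n % 2).toNat, by omega⟩, n / 2, ?_⟩
      have e : n = ((n % 2).toNat : ℤ) + ((2 : ℕ) : ℤ) * (n / 2) := by omega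
      conv_lhs => rw [e]
      rw [_root_.zpow_add, zpow_natCast, _root_.zpow_mul t, zpow_natCast]
    obtain ⟨l, e4⟩ : ∃ l : ℤ, z ^ (k1 + k2 + c) * t ^ (ε : ℕ) = t ^ (ε : ℕ) * z ^ l := by
      fin_cases ε
      · exact ⟨k1 + k2 + c, by simp⟩
      · simpa using hmove (k1 + k2 + c)
    refine ⟨(i, j, ε), ?_⟩
    rw [QuotientGroup.eq]
    have hg : g = x ^ (i : ℕ) * y ^ (j : ℕ) * t ^ (ε : ℕ) * (z ^ l * (t ^ 2) ^ m) := by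
      have e5 : z ^ k1 * y ^ (j : ℕ) = y ^ (j : ℕ) * z ^ k1 := ((hzy.zpow_left k1).pow_right j).eq
      calc g = x ^ (i : ℕ) * (z ^ k1 * y ^ (j : ℕ)) * z ^ k2 * z ^ c * (t ^ (ε : ℕ) * (t ^ 2) ^ m) := by
            rw [h, e1, e2, e3]; simp only [mul_assoc]
        _ = x ^ (i : ℕ) * y ^ (j : ℕ) * (z ^ (k1 + k2 + c) * t ^ (ε : ℕ)) * (t ^ 2) ^ m := by
            rw [e5, _root_.zpow_add, _root_.zpow_add]; simp only [mul_assoc]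
        _ = _ := by rw [e4]; simp only [mul_assoc]
    rw [hg, inv_mul_cancel_left]
    exact B.mul_mem (B.zpow_mem hzB _) (B.zpow_mem htB _)
  refine ⟨B.normalCore, inferInstance, ?_, (core_index B).trans (Nat.factorial_le hBi)⟩
  intro u v
  have := hBc.is_comm.comm ⟨u, B.normalCore_le u.2⟩ ⟨v, B.normalCore_le v.2⟩
  have h2 : (u : G) * v = v * u := congrArg Subtype.val this
  exact Subtype.ext h2

lemma aut_d3 {s : ℕ} (hs : 0 < s) (χ : MulAut (Heis s)) : χ δ₃ = δ₃ ∨ χ δ₃ = δ₃⁻¹ := by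
  have key : ∀ θ : MulAut (Heis s), ∃ p : ℤ, θ δ₃ = δ₃ ^ p := by
    intro θ
    have h1 : (θ δ₃).a = 0 := congrArg Multiplicative.toAdd (hom_d3 hs (pa.comp θ.toMonoidHom))
    have h2 : (θ δ₃).b = 0 := congrArg Multiplicative.toAdd (hom_d3 hs (pb.comp θ.toMonoidHom))
    exact ⟨(θ δ₃).c, by rw [d3_zpow]; ext <;> simp [h1, h2]⟩
  obtain ⟨p, hp⟩ := key χ
  obtain ⟨q, hq⟩ := key χ⁻¹
  have h : χ (χ⁻¹ δ₃) = δ₃ := by simp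
  rw [hq, map_zpow, hp, ← _root_.zpow_mul, d3_zpow] at h
  have h2 : p * q = 1 := congrArg Heis.c h
  rcases Int.eq_one_or_neg_one_of_mul_eq_one h2 with h | h
  · left; rw [hp, h, zpow_one]
  · right; rw [hp, h, _root_.zpow_neg_one]

/-- Lemma A.11: let Γ = Γ₀ ⋊ ℤ with Γ₀ = H(r), where the generator of ℤ acts via an
automorphism ψ inducing the matrix M ∈ GL₂(ℤ) on Γ₀/z(Γ₀) ≅ ℤ², and suppose the
eigenvalues of M are not roots of unity. Then there is a constant ν = ν(Γ) such that
whenever a semidirect product Γ̂ = H(rh) ⋊ ℤ contains Γ as a normal subgroup, the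
quotient G = Γ̂/Γ is finite and has a normal abelian subgroup of index at most ν. -/
theorem stmt_17 (r : ℕ) (hr : 0 < r) (ψ : MulAut (Heis r)) (M : GL (Fin 2) ℤ)
    (hM : InducedMatrix r ψ M)
    (hEig : ∀ μ : ℂ,
      (((M : Matrix (Fin 2) (Fin 2) ℤ).map ((↑) : ℤ → ℂ)).charpoly).IsRoot μ →
        ¬ ∃ k : ℕ, 0 < k ∧ μ ^ k = 1) :
    ∃ ν : ℕ, ∀ (rh : ℕ), 0 < rh → ∀ (ψh : MulAut (Heis rh))
      (K : Subgroup (HeisSdp rh ψh)) [K.Normal],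
      Nonempty (HeisSdp r ψ ≃* K) →
        Finite (HeisSdp rh ψh ⧸ K) ∧
        ∃ A : Subgroup (HeisSdp rh ψh ⧸ K), A.Normal ∧ (∀ x y : A, x * y = y * x) ∧
          A.index ≤ ν := by
  refine ⟨(r * (r * 2)).factorial, ?_⟩
  rintro s hs χ K hK ⟨e⟩
  obtain ⟨⟨g, hgK, hg⟩, ⟨d, hd, hdK⟩, h3⟩ := key hr hM hEig hs χ K e
  let π : HeisSdp s χ →* HeisSdp s χ ⧸ K := QuotientGroup.mk' K
  let ι : Heis s →* HeisSdp s χ ⧸ K := π.comp SemidirectProduct.inl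
  have hπ : ∀ k ∈ K, π k = 1 := fun k hk => (QuotientGroup.eq_one_iff k).2 hk
  let t0 : HeisSdp s χ := SemidirectProduct.inr (Multiplicative.ofAdd 1)
  have ht0 : ∀ n : Multiplicative ℤ, SemidirectProduct.inr n = t0 ^ n.toAdd := by
    intro n
    rw [← map_zpow]
    congr 1
    apply Multiplicative.toAdd.injective
    simp
  have hpow : ∀ x : Heis s, ∃ c : ℤ, ι x ^ r = ι δ₃ ^ c := by
    intro x
    obtain ⟨c, hc⟩ := h3 x
    have h : ι (x ^ r * δ₃ ^ c) = 1 := hπ _ hc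
    refine ⟨-c, ?_⟩
    rw [map_mul, map_pow, map_zpow] at h
    rw [_root_.zpow_neg]
    exact eq_inv_of_mul_eq_one_left h
  have hz : IsOfFinOrder (ι δ₃) := by
    rw [isOfFinOrder_iff_zpow_eq_one]
    refine ⟨d, hd, ?_⟩
    rw [← map_zpow]
    exact hπ _ hdK
  have hall : ∀ x, IsOfFinOrder (ι x) := by
    intro x
    obtain ⟨c, hc⟩ := hpow x
    exact (hc ▸ hz.zpow : IsOfFinOrder (ι x ^ r)).of_pow hr.ne'
  have hsplit : ∀ g : HeisSdp s χ, π g = ι g.left * π t0 ^ g.right.toAdd := by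
    intro g
    conv_lhs => rw [← SemidirectProduct.inl_left_mul_inr_right g]
    rw [map_mul, ht0, map_zpow]; rfl
  have ht : IsOfFinOrder (π t0) := by
    have h := hsplit g
    rw [hπ g hgK] at h
    have h2 : π t0 ^ g.right.toAdd = ι g.left⁻¹ := by
      rw [map_inv]; exact eq_inv_of_mul_eq_one_right h.symm
    have h4 : IsOfFinOrder (π t0 ^ g.right.toAdd) := h2 ▸ hall _
    obtain ⟨n, hn, hn2⟩ := isOfFinOrder_iff_pow_eq_one.1 h4
    rw [isOfFinOrder_iff_zpow_eq_one]
    refine ⟨g.right.toAdd * n, mul_ne_zero (fun h => hg (Multiplicative.toAdd.injective h)) (by omega), ?_⟩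
    rw [_root_.zpow_mul, zpow_natCast, hn2]
  have hrel : t0 * SemidirectProduct.inl δ₃ = SemidirectProduct.inl (χ δ₃) * t0 := by
    ext1 <;> simp [t0]
  refine grp r hr (ι δ₁) (ι δ₂) (ι δ₃) (π t0) ?_ (hpow _) (hpow _) hz ht ?_ ?_
  · intro q
    induction q using QuotientGroup.induction_on with
    | H g =>
    refine ⟨g.left.a, g.left.b, g.left.c - s * g.left.a * g.left.b, g.right.toAdd, ?_⟩
    rw [← map_zpow, ← map_zpow, ← map_zpow, ← map_mul, ← map_mul, ← decomp]
    exact hsplit g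
  · have : (δ₃ : Heis s) * δ₂ = δ₂ * δ₃ := by
      rw [comm_iff hs]; simp [δ₂, δ₃]
    exact (show Commute (δ₃ : Heis s) δ₂ from this).map ι
  · have h := congrArg π hrel
    rw [map_mul, map_mul] at h
    rcases aut_d3 hs χ with h1 | h1
    · left; rw [h1] at h; exact h
    · right; rw [h1, map_inv, map_inv] at h; exact h
end
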